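/- Let q be a prime power and let f : 𝔽_q[x] → ℂ be a 1-bounded multiplicative function. Suppose that for every Dirichlet character χ, every short interval character ξ, and every θ ∈ [0,1), the pretentious distance D(f, χ·ξ·e_θ; N) tends to infinity as N → ∞. Then f is aperiodic. -/

import Mathlib

open Polynomial Filter

/-- The polynomial with coefficient vector `c`, an element of `G_n` (degree < n). -/
noncomputable def polyOf {F : Type*} [Semiring F] {n : ℕ} (c : Fin n → F) : Polynomial F :=
  ∑ i, Polynomial.C (c i) * Polynomial.X ^ (i : ℕ)

/-- Multiplicative function. -/
def IsMultFn {F : Type*} [CommSemiring F] (f : Polynomial F → ℂ) : Prop :=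
  ∀ g h : Polynomial F, IsCoprime g h → f (g * h) = f g * f h

/-- Aperiodic function. -/
def IsAperiodicFn {F : Type*} [Field F] [Fintype F] (f : Polynomial F → ℂ) : Prop :=
  ∀ s : Polynomial F, s ≠ 0 → ∀ a : (Polynomial F ⧸ Ideal.span {s}) → ℂ,
    Tendsto (fun n : ℕ => (1 / (Fintype.card F : ℂ) ^ n) *
        ∑ c : Fin n → F, f (polyOf c) *
          (starRingEnd ℂ) (a (Ideal.Quotient.mk (Ideal.span {s}) (polyOf c))))
      atTop (nhds 0)

/-- Dirichlet character on `𝔽_q[x]`. -/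
def IsDirichletChar {F : Type*} [Field F] (χ : Polynomial F → ℂ) : Prop :=
  (∀ g h : Polynomial F, χ (g * h) = χ g * χ h) ∧
  ∃ s : Polynomial F, s ≠ 0 ∧ (∀ g h : Polynomial F, s ∣ g - h → χ g = χ h) ∧
    (∀ g : Polynomial F, χ g ≠ 0 ↔ IsCoprime g s)

/-- The `i`-th coefficient of `g` from the top (coefficients below the bottom count as 0). -/
noncomputable def topCoeff {F : Type*} [Semiring F] (g : Polynomial F) (i : ℕ) : F :=
  if i ≤ g.natDegree then g.coeff (g.natDegree - i) else 0

/-- Short interval character on `𝔽_q[x]`. -/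
def IsShortIntervalChar {F : Type*} [Field F] (ξ : Polynomial F → ℂ) : Prop :=
  (∀ g h : Polynomial F, IsCoprime g h → ξ (g * h) = ξ g * ξ h) ∧
  (∃ g, ξ g ≠ 0) ∧
  ∃ s : ℕ, ∀ g h : Polynomial F, g ≠ 0 → h ≠ 0 →
    (∀ i ≤ s, topCoeff g i = topCoeff h i) → ξ g = ξ h

/-- The archimedean character `e_θ(g) = exp(2πiθ·deg g)`. -/
noncomputable def eTheta {F : Type*} [Semiring F] (θ : ℝ) (g : Polynomial F) : ℂ :=
  Complex.exp (2 * Real.pi * Complex.I * (θ : ℂ) * (g.natDegree : ℂ))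

/-- The pretentious distance `D(f,g;N)` over monic irreducibles of degree at most `N`. -/
noncomputable def pretDist {F : Type*} [Field F] [Fintype F]
    (f g : Polynomial F → ℂ) (N : ℕ) : ℝ :=
  Real.sqrt (∑' P : {P : Polynomial F // P.Monic ∧ Irreducible P ∧ P.natDegree ≤ N},
    (Fintype.card F : ℝ) ^ (-(P.1.natDegree : ℤ)) *
      (1 - (f P.1 * (starRingEnd ℂ) (g P.1)).re))

section PowerSeriesAnalysis

/-- The continuous function on the circle with absolutely convergent Fourier series
`∑ aₙ e(nθ)` supported on nonnegative frequencies. -/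
noncomputable def circleSeries (a : ℕ → ℂ) : C(UnitAddCircle, ℂ) :=
  ∑' n : ℕ, a n • fourier (n : ℤ)

lemma summable_norm_smul_fourier {a : ℕ → ℂ} (ha : Summable fun n => ‖a n‖) :
    Summable fun n : ℕ => ‖a n • (fourier (n : ℤ) : C(UnitAddCircle, ℂ))‖ := by
  simpa [norm_smul, fourier_norm] using ha

lemma circleSeries_apply {a : ℕ → ℂ} (ha : Summable fun n => ‖a n‖) (x : UnitAddCircle) :
    circleSeries a x = ∑' n : ℕ, a n * fourier (n : ℤ) x := by
  rw [circleSeries, ← ContinuousMap.tsum_apply (summable_norm_smul_fourier ha).of_norm]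
  simp

lemma circleSeries_mul {a b : ℕ → ℂ} (ha : Summable fun n => ‖a n‖)
    (hb : Summable fun n => ‖b n‖) :
    circleSeries a * circleSeries b =
      circleSeries fun n => ∑ kl ∈ Finset.HasAntidiagonal.antidiagonal n, a kl.1 * b kl.2 := by
  unfold circleSeries
  rw [tsum_mul_tsum_eq_tsum_sum_antidiagonal_of_summable_norm (summable_norm_smul_fourier ha)
    (summable_norm_smul_fourier hb)]
  refine tsum_congr fun n => ?_
  ext x
  simp only [ContinuousMap.coe_sum, Finset.sum_apply, ContinuousMap.smul_apply, smul_eq_mul,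
    ContinuousMap.mul_apply, Finset.sum_mul]
  refine Finset.sum_congr rfl fun kl hkl => ?_
  rw [← Finset.HasAntidiagonal.mem_antidiagonal.mp hkl, Nat.cast_add, fourier_add]
  ring

/-- Parseval's identity for absolutely convergent series. -/
lemma hasSum_norm_sq_circleSeries {a : ℕ → ℂ} (ha : Summable fun n => ‖a n‖) :
    HasSum (fun n => ‖a n‖ ^ 2)
      (‖ContinuousMap.toLp (E := ℂ) 2 AddCircle.haarAddCircle ℂ (circleSeries a)‖ ^ 2) := by
  set T := ContinuousMap.toLp (E := ℂ) 2 (AddCircle.haarAddCircle (T := 1)) ℂ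
  have h1 : HasSum (fun n : ℕ => a n • fourierLp 2 (n : ℤ)) (T (circleSeries a)) := by
    have := (summable_norm_smul_fourier ha).of_norm.hasSum.mapL T
    simpa [circleSeries, fourierLp, T] using this
  have horth : ∀ n : ℕ, inner ℂ (fourierLp 2 (n : ℤ)) (T (circleSeries a)) = a n := by
    intro n
    have h2 := h1.mapL (innerSL ℂ (fourierLp (T := 1) 2 (n : ℤ)))
    have h3 := hasSum_single (f := fun m : ℕ => (innerSL ℂ (fourierLp (T := 1) 2 (n : ℤ)))
      (a m • fourierLp 2 (m : ℤ))) n (by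
        intro m hm
        have := orthonormal_fourier (T := 1)
        rw [orthonormal_iff_ite] at this
        simp only [innerSL_apply_apply, inner_smul_right, this]
        rw [if_neg (by exact_mod_cast hm.symm), mul_zero])
    rw [← innerSL_apply_apply, h2.unique h3]
    simp only [innerSL_apply_apply, inner_smul_right]
    rw [inner_self_eq_norm_sq_to_K, (orthonormal_fourier (T := 1)).1]
    simp
  have h4 := h1.mapL (innerSL ℂ (T (circleSeries a)))
  simp only [innerSL_apply_apply, inner_smul_right] at h4
  rw [inner_self_eq_norm_sq_to_K] at h4
  have h5 : ∀ n : ℕ, a n * inner ℂ (T (circleSeries a)) (fourierLp 2 (n : ℤ))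
      = ((‖a n‖ ^ 2 : ℝ) : ℂ) := by
    intro n
    rw [← inner_conj_symm, horth, Complex.mul_conj, Complex.normSq_eq_norm_sq]
  simp only [h5] at h4
  refine Complex.hasSum_ofReal.mp ?_
  rw [Complex.ofReal_pow]
  exact h4

/-- Multiplication by a function bounded by `B` on the circle has operator norm at most `B`
on square-summable coefficient sequences. -/
lemma tsum_norm_sq_cauchy_le {a b : ℕ → ℂ} (ha : Summable fun n => ‖a n‖)
    (hb : Summable fun n => ‖b n‖) {B : ℝ}
    (hB : ∀ x : UnitAddCircle, ‖∑' n : ℕ, b n * fourier (n : ℤ) x‖ ≤ B)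
    {c : ℕ → ℂ} (hc : ∀ n, c n = ∑ kl ∈ Finset.HasAntidiagonal.antidiagonal n, a kl.1 * b kl.2) :
    Summable (fun n => ‖c n‖ ^ 2) ∧ ∑' n, ‖c n‖ ^ 2 ≤ B ^ 2 * ∑' n, ‖a n‖ ^ 2 := by
  obtain rfl : c = _ := funext hc
  have hcs := summable_norm_sum_mul_antidiagonal_of_summable_norm ha hb
  have hP := hasSum_norm_sq_circleSeries hcs
  refine ⟨hP.summable, ?_⟩
  rw [hP.tsum_eq, (hasSum_norm_sq_circleSeries ha).tsum_eq, ← circleSeries_mul ha hb, ← mul_pow]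
  refine pow_le_pow_left₀ (norm_nonneg _) (MeasureTheory.Lp.norm_le_mul_norm_of_ae_le_mul ?_) 2
  filter_upwards [ContinuousMap.coeFn_toLp (p := 2) (𝕜 := ℂ) AddCircle.haarAddCircle
      (circleSeries a * circleSeries b),
    ContinuousMap.coeFn_toLp (p := 2) (𝕜 := ℂ) AddCircle.haarAddCircle
      (circleSeries a)] with x h1 h2
  rw [h1, h2, ContinuousMap.mul_apply, norm_mul, mul_comm]
  refine mul_le_mul_of_nonneg_right ?_ (norm_nonneg _)
  rw [circleSeries_apply hb]
  exact hB x

lemma summable_norm_mul_pow {c : ℕ → ℂ} {C : ℝ} (hc : ∀ n, ‖c n‖ ≤ C) {z : ℂ} (hz : ‖z‖ < 1) :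
    Summable fun n => ‖c n * z ^ n‖ := by
  refine Summable.of_nonneg_of_le (fun n => norm_nonneg _) (fun n => ?_)
    ((summable_geometric_of_lt_one (norm_nonneg z) hz).mul_left C)
  rw [norm_mul, norm_pow]
  exact mul_le_mul_of_nonneg_right (hc n) (by positivity)

lemma hasDerivAt_tsum_mul_pow {c : ℕ → ℂ} {C : ℝ} (hc : ∀ n, ‖c n‖ ≤ C) {z : ℂ}
    (hz : ‖z‖ < 1) :
    HasDerivAt (fun w : ℂ => ∑' n, c n * w ^ n) (∑' n : ℕ, (n + 1 : ℂ) * c (n + 1) * z ^ n) z := by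
  obtain ⟨r, hzr, hr⟩ := exists_between hz
  have hr0 : 0 < r := lt_of_le_of_lt (norm_nonneg z) hzr
  have hrn : ‖(r : ℂ)‖ < 1 := by simpa [abs_of_pos hr0] using hr
  have hC : 0 ≤ C := (norm_nonneg _).trans (hc 0)
  have hu : Summable fun n : ℕ => C * (n * r ^ (n - 1)) := by
    rw [← summable_nat_add_iff 1]
    have h := ((summable_pow_mul_geometric_of_norm_lt_one 1 (r := r)
      (by simpa [abs_of_pos hr0] using hr)).add
      (summable_geometric_of_lt_one hr0.le hr)).mul_left C
    refine h.congr fun n => ?_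
    rw [pow_one, Nat.add_sub_cancel]
    push_cast
    ring
  have key := hasDerivAt_tsum_of_isPreconnected (g := fun (n : ℕ) (w : ℂ) => c n * w ^ n)
    (g' := fun (n : ℕ) (w : ℂ) => c n * (n * w ^ (n - 1))) (t := Metric.ball 0 r) (y₀ := 0) (y := z)
    hu Metric.isOpen_ball (convex_ball _ _).isPreconnected
    (fun n y _ => (hasDerivAt_pow n y).const_mul (c n))
    (fun n y hy => by
      have hy' : ‖y‖ ≤ r := by simpa using (Metric.mem_ball.mp hy).le
      rw [norm_mul, norm_mul, norm_pow, Complex.norm_natCast]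
      gcongr
      exact hc n)
    (by simpa using hr0) (summable_norm_mul_pow hc (by simp)).of_norm (by simpa using hzr)
  refine key.congr_deriv ?_
  rw [Summable.tsum_eq_zero_add (f := fun (n : ℕ) => c n * (n * z ^ (n - 1)))]
  · simp only [Nat.cast_zero, zero_mul, mul_zero, zero_add, Nat.add_sub_cancel]
    exact tsum_congr fun n => by push_cast; ring
  · refine Summable.of_norm ?_
    refine Summable.of_nonneg_of_le (fun n => norm_nonneg _) (fun n => ?_) hu
    rw [norm_mul, norm_mul, norm_pow, Complex.norm_natCast]
    gcongr
    exact hc n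

/-- If `(n+1) s (n+1) = ∑ l k * s (n-k)` then `∑ s n zⁿ = exp (∑ l k z^(k+1)/(k+1))`. -/
lemma tsum_mul_pow_eq_exp {s l : ℕ → ℂ} (hs : ∀ n, ‖s n‖ ≤ 1) (hl : ∀ n, ‖l n‖ ≤ 1)
    (h0 : s 0 = 1)
    (hrec : ∀ n : ℕ, (n + 1 : ℂ) * s (n + 1) =
      ∑ kl ∈ Finset.HasAntidiagonal.antidiagonal n, l kl.1 * s kl.2) {z : ℂ} (hz : ‖z‖ < 1) :
    ∑' n, s n * z ^ n = Complex.exp (∑' k : ℕ, l k * z ^ (k + 1) / (k + 1)) := by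
  set b : ℕ → ℂ := fun n => if n = 0 then 0 else l (n - 1) / n with hb
  have hb1 : ∀ n, ‖b n‖ ≤ 1 := by
    intro n
    rcases n with _ | n
    · simp [hb]
    · simp only [hb, Nat.add_eq_zero_iff, one_ne_zero, and_false, if_false, Nat.add_sub_cancel,
        norm_div, Complex.norm_natCast]
      rw [div_le_one (by positivity)]
      push_cast
      have := hl n
      have : (0 : ℝ) ≤ n := by positivity
      linarith [hl n]
  have hbs : ∀ n : ℕ, (n + 1 : ℂ) * b (n + 1) = l n := by
    intro n
    have : (n + 1 : ℂ) ≠ 0 := by exact_mod_cast n.succ_ne_zero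
    simp only [hb, Nat.add_eq_zero_iff, one_ne_zero, and_false, if_false, Nat.add_sub_cancel]
    push_cast
    field_simp
  have hB : ∀ w : ℂ, ‖w‖ < 1 → ∑' n, b n * w ^ n = ∑' k : ℕ, l k * w ^ (k + 1) / (k + 1) := by
    intro w hw
    rw [(summable_norm_mul_pow hb1 hw).of_norm.tsum_eq_zero_add]
    simp only [hb]
    simp
    exact tsum_congr fun n => by ring
  rw [← hB z hz]
  have hd : ∀ w ∈ Metric.ball (0 : ℂ) 1, HasDerivWithinAt
      (fun w : ℂ => (∑' n, s n * w ^ n) * Complex.exp (-∑' n, b n * w ^ n)) 0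
      (Metric.ball (0 : ℂ) 1) w := by
    intro w hw
    have hw' : ‖w‖ < 1 := by simpa using hw
    have h1 := hasDerivAt_tsum_mul_pow hs hw'
    have h2 := hasDerivAt_tsum_mul_pow hb1 hw'
    have h3 := h1.mul h2.neg.cexp
    refine HasDerivAt.hasDerivWithinAt ?_
    refine h3.congr_deriv ?_
    have h4 : ∑' n : ℕ, (n + 1 : ℂ) * s (n + 1) * w ^ n
        = (∑' n : ℕ, (n + 1 : ℂ) * b (n + 1) * w ^ n) * ∑' n, s n * w ^ n := by
      simp only [hbs]
      rw [tsum_mul_tsum_eq_tsum_sum_antidiagonal_of_summable_norm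
        (summable_norm_mul_pow hl hw') (summable_norm_mul_pow hs hw')]
      refine tsum_congr fun n => ?_
      rw [hrec, Finset.sum_mul]
      refine Finset.sum_congr rfl fun kl hkl => ?_
      rw [← Finset.HasAntidiagonal.mem_antidiagonal.mp hkl, pow_add]
      ring
    rw [h4]
    ring
  have hz0 : z ∈ Metric.ball (0 : ℂ) 1 := by simpa using hz
  have h00 : (0 : ℂ) ∈ Metric.ball (0 : ℂ) 1 := by simp
  have hconst := (convex_ball (0 : ℂ) 1).is_const_of_fderivWithin_eq_zero (𝕜 := ℂ)
    (f := fun w : ℂ => (∑' n, s n * w ^ n) * Complex.exp (-∑' n, b n * w ^ n))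
    (fun w hw => (hd w hw).differentiableWithinAt)
    (fun w hw => by
      have hu := Metric.isOpen_ball.uniqueDiffWithinAt (𝕜 := ℂ) hw
      rw [(hd w hw).hasFDerivWithinAt.fderivWithin hu]
      ext; simp) hz0 h00
  have hs0 : ∑' n, s n * (0 : ℂ) ^ n = 1 := by
    rw [tsum_eq_single 0 (fun n hn => by simp [hn])]; simp [h0]
  have hb0 : ∑' n, b n * (0 : ℂ) ^ n = 0 := by
    rw [tsum_eq_single 0 (fun n hn => by simp [hn])]; simp [hb]
  simp only [hs0, hb0, neg_zero, Complex.exp_zero, mul_one] at hconst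
  rw [Complex.exp_neg] at hconst
  have := Complex.exp_ne_zero (∑' n, b n * z ^ n)
  field_simp at hconst
  exact hconst
end PowerSeriesAnalysis

lemma fourier_eq_pow (n : ℕ) (y : UnitAddCircle) : fourier (n : ℤ) y = fourier 1 y ^ n := by
  induction n with
  | zero => simp
  | succ n ih => rw [Nat.cast_succ, fourier_add, ih, pow_succ]

lemma norm_fourier_apply (n : ℤ) (y : UnitAddCircle) : ‖fourier n y‖ = 1 := by
  rw [fourier_apply]
  exact Circle.norm_coe _

/-- The truncated squared distance of the sequence `l` from the archimedean character `y`. -/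
noncomputable def seqDist (l : ℕ → ℂ) (N : ℕ) (y : UnitAddCircle) : ℝ :=
  ∑ k ∈ Finset.range N, (1 - (l k * fourier (k + 1 : ℤ) y).re) / (k + 1)

lemma seqDist_term_nonneg {l : ℕ → ℂ} (hl : ∀ n, ‖l n‖ ≤ 1) (k : ℕ) (y : UnitAddCircle) :
    0 ≤ 1 - (l k * fourier (k + 1 : ℤ) y).re := by
  have h := Complex.re_le_norm (l k * fourier (k + 1 : ℤ) y)
  rw [norm_mul, norm_fourier_apply, mul_one] at h
  linarith [hl k]

lemma seqDist_mono {l : ℕ → ℂ} (hl : ∀ n, ‖l n‖ ≤ 1) (y : UnitAddCircle) :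
    Monotone fun N => seqDist l N y := by
  refine monotone_nat_of_le_succ fun N => ?_
  rw [seqDist, seqDist, Finset.sum_range_succ]
  have := seqDist_term_nonneg hl N y
  have : 0 ≤ (1 - (l N * fourier (N + 1 : ℤ) y).re) / (N + 1) := by positivity
  linarith

lemma exists_forall_le_seqDist {l : ℕ → ℂ} (hl : ∀ n, ‖l n‖ ≤ 1)
    (hdiv : ∀ y, Tendsto (fun N => seqDist l N y) atTop atTop) (M : ℝ) :
    ∃ N, ∀ y, M < seqDist l N y := by
  obtain ⟨N, hN⟩ := isCompact_univ.elim_directed_cover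
    (fun N => {y : UnitAddCircle | M < seqDist l N y})
    (fun N => by
      refine isOpen_lt continuous_const ?_
      unfold seqDist
      fun_prop)
    (fun y _ => by
      obtain ⟨N, hN⟩ := ((hdiv y).eventually_gt_atTop M).exists
      exact Set.mem_iUnion.mpr ⟨N, hN⟩)
    (directed_of_isDirected_le fun i j hij y (hy : M < seqDist l i y) =>
      hy.trans_le (seqDist_mono hl y hij))
  exact ⟨N, fun y => hN (Set.mem_univ y)⟩

/-- On the circle of radius `r` the generating function is at most `exp(-D²/2) / (1 - r)`
once `r ^ N ≥ 1/2`. -/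
lemma norm_tsum_le_of_seqDist {s l : ℕ → ℂ} (hs : ∀ n, ‖s n‖ ≤ 1) (hl : ∀ n, ‖l n‖ ≤ 1)
    (h0 : s 0 = 1)
    (hrec : ∀ n : ℕ, (n + 1 : ℂ) * s (n + 1) =
      ∑ kl ∈ Finset.HasAntidiagonal.antidiagonal n, l kl.1 * s kl.2)
    {r : ℝ} (hr0 : 0 < r) (hr1 : r < 1) {N : ℕ} (hN : 1 / 2 ≤ r ^ N) (y : UnitAddCircle) :
    ‖∑' n : ℕ, s n * (r : ℂ) ^ n * fourier (n : ℤ) y‖ ≤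
      Real.exp (-(seqDist l N y / 2)) / (1 - r) := by
  set z : ℂ := r * fourier 1 y with hz
  have hzn : ‖z‖ = r := by
    rw [hz, norm_mul, norm_fourier_apply, mul_one]; simp [abs_of_pos hr0]
  have hz1 : ‖z‖ < 1 := hzn ▸ hr1
  have hzp : ∀ n : ℕ, z ^ n = (r : ℂ) ^ n * fourier (n : ℤ) y := by
    intro n; rw [hz, mul_pow, fourier_eq_pow]
  have e1 : ∑' n : ℕ, s n * (r : ℂ) ^ n * fourier (n : ℤ) y = ∑' n, s n * z ^ n :=
    tsum_congr fun n => by rw [hzp, mul_assoc]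
  rw [e1, tsum_mul_pow_eq_exp hs hl h0 hrec hz1, Complex.norm_exp]
  have hlog := Real.hasSum_pow_div_log_of_abs_lt_one (x := r) (by rwa [abs_of_pos hr0])
  have hsum : Summable fun k : ℕ => l k * z ^ (k + 1) / (k + 1) := by
    refine Summable.of_norm (Summable.of_nonneg_of_le (fun _ => norm_nonneg _) (fun k => ?_)
      hlog.summable)
    rw [norm_div, norm_mul, norm_pow, hzn, show ‖(k + 1 : ℂ)‖ = k + 1 by
      rw [← Nat.cast_succ, Complex.norm_natCast]; simp]
    gcongr
    have := hl k
    have h2 : 0 ≤ r ^ (k + 1) := by positivity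
    nlinarith
  have hre := Complex.hasSum_re hsum.hasSum
  have hdiff := hlog.sub hre
  have hterm : ∀ k : ℕ, r ^ (k + 1) / ((k : ℝ) + 1) - (l k * z ^ (k + 1) / (k + 1)).re
      = r ^ (k + 1) * ((1 - (l k * fourier (k + 1 : ℤ) y).re) / (k + 1)) := by
    intro k
    have h1 : l k * z ^ (k + 1) / (k + 1)
        = ((r ^ (k + 1) / (k + 1) : ℝ) : ℂ) * (l k * fourier (k + 1 : ℤ) y) := by
      rw [hzp]; push_cast; ring
    rw [h1, Complex.re_ofReal_mul]
    ring
  simp only [hterm] at hdiff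
  have hpos : ∀ k : ℕ, 0 ≤ (1 - (l k * fourier (k + 1 : ℤ) y).re) / (k + 1) := fun k => by
    have := seqDist_term_nonneg hl k y
    positivity
  have hle : seqDist l N y / 2 ≤ -Real.log (1 - r) - (∑' k : ℕ, l k * z ^ (k + 1) / (k + 1)).re := by
    refine le_trans ?_ (sum_le_hasSum (Finset.range N)
      (fun k _ => mul_nonneg (by positivity) (hpos k)) hdiff)
    rw [seqDist, Finset.sum_div]
    refine Finset.sum_le_sum fun k hk => ?_
    have h1 : r ^ N ≤ r ^ (k + 1) := pow_le_pow_of_le_one hr0.le hr1.le (by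
      have := Finset.mem_range.mp hk; omega)
    have h2 := mul_le_mul_of_nonneg_right (hN.trans h1) (hpos k)
    linarith
  have h1r : 0 < 1 - r := by linarith
  calc Real.exp (∑' k : ℕ, l k * z ^ (k + 1) / (k + 1)).re
      ≤ Real.exp (-(seqDist l N y / 2) - Real.log (1 - r)) := Real.exp_le_exp.mpr (by linarith)
    _ = _ := by rw [Real.exp_sub, Real.exp_log h1r]

/-- The weighted second moment of `s` is bounded through Parseval's identity. -/
lemma tsum_sq_le_of_norm_le {s l : ℕ → ℂ} (hs : ∀ n, ‖s n‖ ≤ 1) (hl : ∀ n, ‖l n‖ ≤ 1)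
    (hrec : ∀ n : ℕ, (n + 1 : ℂ) * s (n + 1) =
      ∑ kl ∈ Finset.HasAntidiagonal.antidiagonal n, l kl.1 * s kl.2)
    {r B : ℝ} (hr0 : 0 < r) (hr1 : r < 1)
    (hB : ∀ y : UnitAddCircle, ‖∑' n : ℕ, s n * (r : ℂ) ^ n * fourier (n : ℤ) y‖ ≤ B) (N : ℕ) :
    ∑ n ∈ Finset.range N, ((n + 1) * ‖s (n + 1)‖ * r ^ n) ^ 2 ≤ B ^ 2 / (1 - r) := by
  have hrn : ‖(r : ℂ)‖ < 1 := by simpa [abs_of_pos hr0] using hr1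
  have hl' := summable_norm_mul_pow hl hrn
  have hs' := summable_norm_mul_pow hs hrn
  obtain ⟨h1, h2⟩ := tsum_norm_sq_cauchy_le hl' hs' hB
    (c := fun n => (n + 1 : ℂ) * s (n + 1) * (r : ℂ) ^ n) (fun n => by
      rw [hrec, Finset.sum_mul]
      refine Finset.sum_congr rfl fun kl hkl => ?_
      rw [← Finset.HasAntidiagonal.mem_antidiagonal.mp hkl, pow_add]
      ring)
  have hnorm : ∀ n : ℕ, ‖(n + 1 : ℂ) * s (n + 1) * (r : ℂ) ^ n‖
      = (n + 1) * ‖s (n + 1)‖ * r ^ n := by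
    intro n
    rw [norm_mul, norm_mul, norm_pow, show ‖(n + 1 : ℂ)‖ = n + 1 by
      rw [← Nat.cast_succ, Complex.norm_natCast]; simp]
    simp [abs_of_pos hr0]
  simp only [hnorm] at h1 h2
  have h3 : ∑' n, ‖l n * (r : ℂ) ^ n‖ ^ 2 ≤ 1 / (1 - r) := by
    have hle : ∀ n, ‖l n * (r : ℂ) ^ n‖ ^ 2 ≤ r ^ n := by
      intro n
      have hn : ‖l n * (r : ℂ) ^ n‖ ≤ r ^ n := by
        rw [norm_mul, norm_pow, Complex.norm_real, Real.norm_of_nonneg hr0.le]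
        exact mul_le_of_le_one_left (by positivity) (hl n)
      have h1 : r ^ n ≤ 1 := pow_le_one₀ hr0.le hr1.le
      nlinarith [norm_nonneg (l n * (r : ℂ) ^ n)]
    have hg := summable_geometric_of_lt_one hr0.le hr1
    rw [one_div, ← tsum_geometric_of_lt_one hr0.le hr1]
    exact Summable.tsum_le_tsum hle
      (Summable.of_nonneg_of_le (fun _ => by positivity) hle hg) hg
  calc _ ≤ _ := h1.sum_le_tsum _ (fun _ _ => by positivity)
    _ ≤ _ := h2
    _ ≤ B ^ 2 * (1 / (1 - r)) := by gcongr
    _ = _ := by ring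

lemma norm_succ_mul_le {s l : ℕ → ℂ} (hl : ∀ n, ‖l n‖ ≤ 1)
    (hrec : ∀ n : ℕ, (n + 1 : ℂ) * s (n + 1) =
      ∑ kl ∈ Finset.HasAntidiagonal.antidiagonal n, l kl.1 * s kl.2) (n : ℕ) :
    (n + 1) * ‖s (n + 1)‖ ≤ ∑ k ∈ Finset.range (n + 1), ‖s k‖ := by
  have h1 : ‖(n + 1 : ℂ) * s (n + 1)‖ = (n + 1) * ‖s (n + 1)‖ := by
    rw [norm_mul, ← Nat.cast_succ, Complex.norm_natCast]; simp
  rw [← h1, hrec]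
  refine (norm_sum_le _ _).trans ?_
  rw [Finset.Nat.sum_antidiagonal_eq_sum_range_succ (fun i j => ‖l i * s j‖),
    ← Finset.sum_range_reflect]
  refine Finset.sum_le_sum fun k hk => ?_
  have := Finset.mem_range.mp hk
  rw [norm_mul, show n - (n + 1 - 1 - k) = k by omega]
  exact mul_le_of_le_one_left (norm_nonneg _) (hl _)

/-- Halász's theorem for sequences satisfying the convolution recurrence. -/
theorem tendsto_zero_of_seqDist {s l : ℕ → ℂ} (hs : ∀ n, ‖s n‖ ≤ 1) (hl : ∀ n, ‖l n‖ ≤ 1)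
    (h0 : s 0 = 1)
    (hrec : ∀ n : ℕ, (n + 1 : ℂ) * s (n + 1) =
      ∑ kl ∈ Finset.HasAntidiagonal.antidiagonal n, l kl.1 * s kl.2)
    (hdiv : ∀ y, Tendsto (fun N => seqDist l N y) atTop atTop) :
    Tendsto s atTop (nhds 0) := by
  rw [← tendsto_add_atTop_iff_nat 1, tendsto_zero_iff_norm_tendsto_zero]
  suffices H : ∀ δ : ℝ, 0 < δ → δ ≤ 1 → ∀ᶠ n : ℕ in atTop, ‖s (n + 1)‖ ≤ 20 * δ by
    refine squeeze_zero_norm' (a := fun n => ‖s (n + 1)‖) (by simp) ?_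
    rw [Metric.tendsto_atTop]
    intro ε hε
    obtain ⟨n0, hn0⟩ := eventually_atTop.mp (H (min 1 (ε / 40)) (by positivity) (min_le_left _ _))
    refine ⟨n0, fun n hn => ?_⟩
    rw [Real.dist_eq, sub_zero, abs_norm]
    have := hn0 n hn
    have := min_le_right 1 (ε / 40)
    linarith
  intro δ hδ hδ1
  obtain ⟨N, hN⟩ := exists_forall_le_seqDist hl hdiv (-(2 * Real.log (δ ^ 2)))
  have hrN : Tendsto (fun n : ℕ => (1 - 1 / ((n : ℝ) + 1)) ^ N) atTop (nhds 1) := by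
    have := (tendsto_const_nhds (x := (1 : ℝ))).sub (tendsto_one_div_add_atTop_nhds_zero_nat (𝕜 := ℝ))
    simpa using this.pow N
  have hlarge : ∀ᶠ n : ℕ in atTop, 1 / δ ≤ n := tendsto_natCast_atTop_atTop.eventually_ge_atTop _
  filter_upwards [hrN.eventually (lt_mem_nhds (show (1 / 2 : ℝ) < 1 by norm_num)), hlarge,
    eventually_ge_atTop 1] with n hn hnδ hn1
  have hn1' : (1 : ℝ) ≤ n := by exact_mod_cast hn1
  set r : ℝ := 1 - 1 / ((n : ℝ) + 1) with hr
  have hr0 : 0 < r := by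
    rw [hr, sub_pos, div_lt_one (by positivity)]; linarith
  have hr1 : r < 1 := by
    rw [hr]; have : 0 < 1 / ((n : ℝ) + 1) := by positivity
    linarith
  have h1r : 1 - r = 1 / ((n : ℝ) + 1) := by rw [hr]; ring
  have hB : ∀ y : UnitAddCircle, ‖∑' k : ℕ, s k * (r : ℂ) ^ k * fourier (k : ℤ) y‖ ≤ δ ^ 2 * (n + 1) := by
    intro y
    refine (norm_tsum_le_of_seqDist hs hl h0 hrec hr0 hr1 hn.le y).trans ?_
    rw [h1r, div_div_eq_mul_div, div_one]
    gcongr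
    rw [← Real.le_log_iff_exp_le (by positivity)]
    linarith [hN y]
  have hmom := tsum_sq_le_of_norm_le hs hl hrec hr0 hr1 hB n
  rw [h1r, div_div_eq_mul_div, div_one] at hmom
  have hrn : ∀ k ∈ Finset.range n, 1 / 4 ≤ r ^ k := by
    intro k hk
    have hk' : k ≤ n := (Finset.mem_range.mp hk).le
    refine le_trans ?_ (pow_le_pow_of_le_one hr0.le hr1.le hk')
    have h2 : r⁻¹ = 1 + 1 / n := by
      have h5 : r = n / (n + 1) := by rw [hr]; field_simp; ring
      have : (n : ℝ) ≠ 0 := by positivity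
      rw [h5, inv_div, add_div, div_self this]
    have h3 : (r⁻¹) ^ n ≤ 4 := by
      rw [h2]
      have : (1 + 1 / (n : ℝ)) ^ n ≤ Real.exp 1 := by
        calc (1 + 1 / (n : ℝ)) ^ n ≤ (Real.exp (1 / n)) ^ n := by
              gcongr; linarith [Real.add_one_le_exp (1 / (n : ℝ))]
          _ = Real.exp 1 := by rw [← Real.exp_nat_mul]; congr 1; field_simp
      linarith [Real.exp_one_lt_d9]
    rw [inv_pow] at h3
    have h4 : 0 < r ^ n := by positivity
    rw [inv_le_comm₀ h4 (by norm_num)] at h3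
    linarith
  have hpt : ∀ k ∈ Finset.range n, ‖s (k + 1)‖ ≤ (if (k : ℝ) + 1 ≤ δ * n then 1 else 0) + δ +
      16 / (4 * δ ^ 3 * n ^ 2) * ((k + 1) * ‖s (k + 1)‖ * r ^ k) ^ 2 := by
    intro k hk
    split_ifs with hkn
    · have := hs (k + 1)
      have : 0 ≤ 16 / (4 * δ ^ 3 * n ^ 2) * ((k + 1) * ‖s (k + 1)‖ * r ^ k) ^ 2 := by positivity
      linarith
    · push Not at hkn
      have h1 := hrn k hk
      set t := ‖s (k + 1)‖ with ht
      have ht0 : 0 ≤ t := norm_nonneg _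
      have h5 : δ * n * t / 4 ≤ (k + 1) * t * r ^ k := by
        have : δ * n * t * (1 / 4) ≤ (k + 1) * t * r ^ k := by gcongr
        linarith
      have h6 : t ^ 2 / (4 * δ) ≤ 16 / (4 * δ ^ 3 * n ^ 2) * ((k + 1) * t * r ^ k) ^ 2 := by
        calc t ^ 2 / (4 * δ) = 16 / (4 * δ ^ 3 * n ^ 2) * (δ * n * t / 4) ^ 2 := by
              field_simp; norm_num
          _ ≤ _ := by gcongr
      have h7 : t ≤ δ + t ^ 2 / (4 * δ) := by
        rw [← sub_nonneg]
        have : δ + t ^ 2 / (4 * δ) - t = (t - 2 * δ) ^ 2 / (4 * δ) := by field_simp; ring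
        rw [this]; positivity
      linarith
  have hcount : ∑ k ∈ Finset.range n, (if (k : ℝ) + 1 ≤ δ * n then (1 : ℝ) else 0) ≤ δ * n := by
    rw [← Finset.sum_filter, Finset.sum_const, nsmul_eq_mul, mul_one]
    have hsub : (Finset.range n).filter (fun k : ℕ => (k : ℝ) + 1 ≤ δ * n) ⊆
        Finset.range ⌊δ * n⌋₊ := by
      intro k hk
      rw [Finset.mem_filter] at hk
      rw [Finset.mem_range, ← Nat.succ_le_iff, Nat.le_floor_iff (by positivity)]
      push_cast
      exact hk.2
    calc _ ≤ (⌊δ * n⌋₊ : ℝ) := by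
          have := Finset.card_le_card hsub
          rw [Finset.card_range] at this
          exact_mod_cast this
      _ ≤ _ := Nat.floor_le (by positivity)
  have hsum := norm_succ_mul_le hl hrec n
  rw [Finset.sum_range_succ'] at hsum
  have hs1 := Finset.sum_le_sum hpt
  rw [Finset.sum_add_distrib, Finset.sum_add_distrib, Finset.sum_const, Finset.card_range,
    nsmul_eq_mul, ← Finset.mul_sum] at hs1
  have hm2 : 16 / (4 * δ ^ 3 * n ^ 2) *
      ∑ k ∈ Finset.range n, ((k + 1) * ‖s (k + 1)‖ * r ^ k) ^ 2 ≤ 16 * δ * (n + 1) := by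
    calc _ ≤ 16 / (4 * δ ^ 3 * n ^ 2) * ((δ ^ 2 * (n + 1)) ^ 2 * (n + 1)) := by gcongr
      _ = 4 * δ * (n + 1) * ((n + 1) / n) ^ 2 := by field_simp; ring
      _ ≤ 4 * δ * (n + 1) * 2 ^ 2 := by
          gcongr
          rw [div_le_iff₀ (by positivity)]; linarith
      _ = _ := by ring
  have hδn : 1 ≤ δ * n := by
    rw [div_le_iff₀ hδ] at hnδ; linarith
  have hfin : (n + 1) * ‖s (n + 1)‖ ≤ (n + 1) * (20 * δ) := by
    have := hs 0
    nlinarith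
  exact le_of_mul_le_mul_left hfin (by positivity)

section MonicPolynomials

open UniqueFactorizationMonoid

variable {F : Type*} [Field F]

open scoped Classical in
/-- The multiset of monic irreducible factors of a polynomial. -/
noncomputable def monicFactors (g : F[X]) : Multiset F[X] := normalizedFactors g

lemma mem_monicFactors {g P : F[X]} (hg : g ≠ 0) :
    P ∈ monicFactors g ↔ P.Monic ∧ Irreducible P ∧ P ∣ g := by
  classical
  rw [monicFactors, mem_normalizedFactors_iff' hg]
  refine ⟨fun ⟨h1, h2, h3⟩ => ⟨?_, h1, h3⟩, fun ⟨h1, h2, h3⟩ => ⟨h2, ?_, h3⟩⟩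
  · exact (normalize_eq_self_iff_monic h1.ne_zero).mp h2
  · exact h1.normalize_eq_self

lemma monic_of_mem_monicFactors {g P : F[X]} (h : P ∈ monicFactors g) : P.Monic := by
  by_cases hg : g = 0
  · subst hg; simp [monicFactors] at h
  · exact ((mem_monicFactors hg).mp h).1

lemma irreducible_of_mem_monicFactors {g P : F[X]} (h : P ∈ monicFactors g) : Irreducible P := by
  classical exact irreducible_of_normalized_factor _ h

lemma prod_monicFactors {g : F[X]} (hg : g.Monic) : (monicFactors g).prod = g := by
  classical
  rw [monicFactors, prod_normalizedFactors_eq hg.ne_zero]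
  exact hg.normalize_eq_self

lemma monicFactors_mul {g h : F[X]} (hg : g ≠ 0) (hh : h ≠ 0) :
    monicFactors (g * h) = monicFactors g + monicFactors h := by
  classical exact normalizedFactors_mul hg hh

lemma monicFactors_one : monicFactors (1 : F[X]) = 0 := by
  classical exact normalizedFactors_one

lemma monicFactors_multiset_prod {m : Multiset F[X]}
    (hm : ∀ P ∈ m, P.Monic ∧ Irreducible P) : monicFactors m.prod = m := by
  classical
  rw [monicFactors, normalizedFactors_prod_eq _ fun P hP => (hm P hP).2]
  conv_rhs => rw [← Multiset.map_id m]
  exact Multiset.map_congr rfl fun P hP => (hm P hP).1.normalize_eq_self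

open scoped Classical in
lemma pow_dvd_iff_le_count {g P : F[X]} (hg : g ≠ 0) (hP : P.Monic) (hi : Irreducible P) (j : ℕ) :
    P ^ j ∣ g ↔ j ≤ (monicFactors g).count P := by
  rw [Multiset.le_count_iff_replicate_le, monicFactors,
    dvd_iff_normalizedFactors_le_normalizedFactors (pow_ne_zero _ hP.ne_zero) hg,
    normalizedFactors_pow, normalizedFactors_irreducible hi, hP.normalize_eq_self,
    Multiset.nsmul_singleton]

lemma natDegree_eq_sum_monicFactors {g : F[X]} (hg : g.Monic) :
    g.natDegree = ((monicFactors g).map natDegree).sum := by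
  conv_lhs => rw [← prod_monicFactors hg]
  exact natDegree_multiset_prod_of_monic _ fun P hP => monic_of_mem_monicFactors hP

lemma monic_multiset_prod {m : Multiset F[X]} (hm : ∀ P ∈ m, P.Monic) : m.prod.Monic := by
  have := monic_multiset_prod_of_monic m id (by simpa using hm)
  simpa using this

/-- The completely multiplicative function with prescribed values on monic irreducibles. -/
noncomputable def complMul (u : F[X] → ℂ) (g : F[X]) : ℂ := ((monicFactors g).map u).prod

lemma complMul_one (u : F[X] → ℂ) : complMul u 1 = 1 := by
  simp [complMul, monicFactors_one]

lemma complMul_mul (u : F[X] → ℂ) {g h : F[X]} (hg : g ≠ 0) (hh : h ≠ 0) :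
    complMul u (g * h) = complMul u g * complMul u h := by
  simp [complMul, monicFactors_mul hg hh]

lemma complMul_pow_irreducible (u : F[X] → ℂ) {P : F[X]} (hP : P.Monic) (hi : Irreducible P)
    (j : ℕ) : complMul u (P ^ j) = u P ^ j := by
  rw [complMul, ← Multiset.prod_replicate, monicFactors_multiset_prod]
  · simp
  · intro Q hQ
    rw [Multiset.eq_of_mem_replicate hQ]
    exact ⟨hP, hi⟩

lemma norm_multiset_prod_le_one {m : Multiset ℂ} (hm : ∀ x ∈ m, ‖x‖ ≤ 1) : ‖m.prod‖ ≤ 1 := by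
  induction m using Multiset.induction_on with
  | empty => simp
  | cons a m ih =>
    rw [Multiset.prod_cons, norm_mul]
    exact mul_le_one₀ (hm a (Multiset.mem_cons_self a m)) (norm_nonneg _)
      (ih fun x hx => hm x (Multiset.mem_cons_of_mem hx))

lemma norm_complMul_le_one {u : F[X] → ℂ} (hu : ∀ P, ‖u P‖ ≤ 1) (g : F[X]) :
    ‖complMul u g‖ ≤ 1 := by
  refine norm_multiset_prod_le_one fun x hx => ?_
  obtain ⟨P, -, rfl⟩ := Multiset.mem_map.mp hx
  exact hu P

lemma coeff_polyOf {n : ℕ} (c : Fin n → F) (k : Fin n) : (polyOf c).coeff k = c k := by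
  rw [polyOf, finsetSum_coeff, Finset.sum_eq_single k]
  · simp
  · intro i _ hi
    rw [coeff_C_mul, coeff_X_pow, if_neg (fun h => hi (Fin.ext h.symm)), mul_zero]
  · simp

lemma degree_polyOf_lt {n : ℕ} (c : Fin n → F) : (polyOf c).degree < n := by
  rw [polyOf, ← mem_degreeLT]
  refine Submodule.sum_mem _ fun i _ => mem_degreeLT.mpr ?_
  exact (degree_C_mul_X_pow_le _ _).trans_lt (by exact_mod_cast i.2)

lemma polyOf_injective (n : ℕ) : Function.Injective (polyOf : (Fin n → F) → F[X]) := by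
  intro c d h
  ext i
  rw [← coeff_polyOf c, h, coeff_polyOf]

variable [Fintype F]

open scoped Classical in
variable (F) in
/-- The finite set of monic polynomials of degree `n`. -/
noncomputable def monics (n : ℕ) : Finset F[X] :=
  Finset.univ.image fun c : Fin n → F => X ^ n + polyOf c

lemma mem_monics {n : ℕ} {g : F[X]} : g ∈ monics F n ↔ g.Monic ∧ g.natDegree = n := by
  classical
  rw [monics, Finset.mem_image]
  constructor
  · rintro ⟨c, -, rfl⟩
    refine ⟨monic_X_pow_add (degree_polyOf_lt c), natDegree_eq_of_degree_eq_some ?_⟩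
    rw [degree_add_eq_left_of_degree_lt] <;> rw [degree_X_pow]
    exact degree_polyOf_lt c
  · rintro ⟨hm, rfl⟩
    refine ⟨fun i => g.coeff i, Finset.mem_univ _, ?_⟩
    conv_rhs => rw [hm.as_sum]
    rw [polyOf, Finset.sum_range]

lemma sum_monics {M : Type*} [AddCommMonoid M] (n : ℕ) (φ : F[X] → M) :
    ∑ g ∈ monics F n, φ g = ∑ c : Fin n → F, φ (X ^ n + polyOf c) := by
  classical
  rw [monics, Finset.sum_image]
  intro c _ d _ h
  exact polyOf_injective n (add_left_cancel h)

lemma card_monics (n : ℕ) : (monics F n).card = Fintype.card F ^ n := by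
  rw [Finset.card_eq_sum_ones, sum_monics]
  simp

/-- Monic multiples of `D` of degree `n`, as products `D * h`. -/
lemma sum_monics_dvd {M : Type*} [AddCommMonoid M] {D : F[X]} (hD : D.Monic) (n : ℕ)
    (φ : F[X] → M) [DecidablePred fun g => D ∣ g] :
    ∑ g ∈ (monics F n).filter (D ∣ ·), φ g =
      if D.natDegree ≤ n then ∑ h ∈ monics F (n - D.natDegree), φ (D * h) else 0 := by
  split_ifs with hn
  · refine (Finset.sum_bij (fun h _ => D * h) ?_ ?_ ?_ ?_).symm
    · intro h hh
      obtain ⟨h1, h2⟩ := mem_monics.mp hh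
      refine Finset.mem_filter.mpr ⟨mem_monics.mpr ⟨hD.mul h1, ?_⟩, dvd_mul_right _ _⟩
      rw [hD.natDegree_mul h1, h2]; omega
    · intro h _ h' _ heq
      exact mul_left_cancel₀ hD.ne_zero heq
    · intro g hg
      obtain ⟨hg1, h, rfl⟩ := Finset.mem_filter.mp hg
      obtain ⟨h1, h2⟩ := mem_monics.mp hg1
      have hh := hD.of_mul_monic_left h1
      refine ⟨h, mem_monics.mpr ⟨hh, ?_⟩, rfl⟩
      rw [hD.natDegree_mul hh] at h2; omega
    · intro h _; rfl
  · refine Finset.sum_eq_zero fun g hg => absurd ?_ hn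
    obtain ⟨hg1, hg2⟩ := Finset.mem_filter.mp hg
    obtain ⟨h1, h2⟩ := mem_monics.mp hg1
    exact h2 ▸ natDegree_le_of_dvd hg2 h1.ne_zero

open scoped Classical in
variable (F) in
/-- The finite set of monic irreducible polynomials of degree at most `n`. -/
noncomputable def monicIrreds (n : ℕ) : Finset F[X] :=
  ((Finset.range (n + 1)).biUnion (monics F)).filter Irreducible

lemma mem_monicIrreds {n : ℕ} {P : F[X]} :
    P ∈ monicIrreds F n ↔ P.Monic ∧ Irreducible P ∧ P.natDegree ≤ n := by
  classical
  simp only [monicIrreds, Finset.mem_filter, Finset.mem_biUnion, Finset.mem_range, mem_monics]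
  constructor
  · rintro ⟨⟨k, hk, hm, rfl⟩, hi⟩
    exact ⟨hm, hi, by omega⟩
  · rintro ⟨hm, hi, hd⟩
    exact ⟨⟨_, by omega, hm, rfl⟩, hi⟩

/-- The sum of `Λ(g) u(g)` over monic prime powers of degree `k`. -/
noncomputable def mangoldtSum (u : F[X] → ℂ) (k : ℕ) : ℂ :=
  ∑ P ∈ monicIrreds F k, ∑ j ∈ Finset.Icc 1 k,
    if j * P.natDegree = k then (P.natDegree : ℂ) * u P ^ j else 0

lemma mangoldtSum_eq_of_le (u : F[X] → ℂ) {k n : ℕ} (hkn : k ≤ n) :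
    mangoldtSum u k = ∑ P ∈ monicIrreds F n, ∑ j ∈ Finset.Icc 1 n,
      if j * P.natDegree = k then (P.natDegree : ℂ) * u P ^ j else 0 := by
  rw [mangoldtSum]
  trans ∑ P ∈ monicIrreds F k, ∑ j ∈ Finset.Icc 1 n,
      if j * P.natDegree = k then (P.natDegree : ℂ) * u P ^ j else 0
  · refine Finset.sum_congr rfl fun P hP => Finset.sum_subset (Finset.Icc_subset_Icc_right hkn) ?_
    intro j hj hj'
    have hd := (mem_monicIrreds.mp hP).2.1.natDegree_pos
    rw [if_neg]
    intro h
    simp only [Finset.mem_Icc, not_and, not_le] at hj hj'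
    have := hj' hj.1
    nlinarith
  · refine Finset.sum_subset ?_ ?_
    · intro P hP
      rw [mem_monicIrreds] at hP ⊢
      exact ⟨hP.1, hP.2.1, hP.2.2.trans hkn⟩
    · intro P hP hP'
      refine Finset.sum_eq_zero fun j hj => if_neg fun h => hP' ?_
      rw [mem_monicIrreds] at hP ⊢
      refine ⟨hP.1, hP.2.1, ?_⟩
      have := (Finset.mem_Icc.mp hj).1
      nlinarith

open scoped Classical in
/-- The degree of a monic polynomial is the sum of the degrees of its prime power divisors. -/
lemma natDegree_eq_sum_prime_powers {g : F[X]} {n : ℕ} (hg : g ∈ monics F n) :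
    n = ∑ P ∈ monicIrreds F n, ∑ j ∈ Finset.Icc 1 n, if P ^ j ∣ g then P.natDegree else 0 := by
  obtain ⟨hm, hn⟩ := mem_monics.mp hg
  conv_lhs => rw [← hn, natDegree_eq_sum_monicFactors hm, Finset.sum_multiset_map_count]
  have hsub : (monicFactors g).toFinset ⊆ monicIrreds F n := by
    intro P hP
    rw [Multiset.mem_toFinset, mem_monicFactors hm.ne_zero] at hP
    exact mem_monicIrreds.mpr ⟨hP.1, hP.2.1, hn ▸ natDegree_le_of_dvd hP.2.2 hm.ne_zero⟩
  rw [Finset.sum_subset hsub fun P _ hP => by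
    rw [Multiset.mem_toFinset, ← Multiset.count_eq_zero] at hP; simp [hP]]
  refine Finset.sum_congr rfl fun P hP => ?_
  obtain ⟨h1, h2, h3⟩ := mem_monicIrreds.mp hP
  simp only [pow_dvd_iff_le_count hm.ne_zero h1 h2]
  rw [← Finset.sum_filter, Finset.sum_const, smul_eq_mul, smul_eq_mul]
  congr 1
  have hc : (monicFactors g).count P ≤ n := by
    have hd := natDegree_le_of_dvd ((pow_dvd_iff_le_count hm.ne_zero h1 h2 _).mpr le_rfl) hm.ne_zero
    rw [natDegree_pow, hn] at hd
    have := h2.natDegree_pos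
    nlinarith
  have : (Finset.Icc 1 n).filter (· ≤ (monicFactors g).count P)
      = Finset.Icc 1 ((monicFactors g).count P) := by
    ext j; simp only [Finset.mem_filter, Finset.mem_Icc]; omega
  rw [this]; simp

/-- The convolution identity between sums of a completely multiplicative function and its
von Mangoldt sums. -/
lemma mul_sum_complMul (u : F[X] → ℂ) (n : ℕ) :
    (n : ℂ) * ∑ g ∈ monics F n, complMul u g =
      ∑ k ∈ Finset.Icc 1 n, mangoldtSum u k * ∑ h ∈ monics F (n - k), complMul u h := by
  classical
  set S : ℕ → ℂ := fun k => ∑ h ∈ monics F k, complMul u h with hS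
  have hL : (n : ℂ) * S n = ∑ P ∈ monicIrreds F n, ∑ j ∈ Finset.Icc 1 n,
      if j * P.natDegree ≤ n then P.natDegree * u P ^ j * S (n - j * P.natDegree) else 0 := by
    calc (n : ℂ) * S n = ∑ g ∈ monics F n, ∑ P ∈ monicIrreds F n, ∑ j ∈ Finset.Icc 1 n,
          if P ^ j ∣ g then (P.natDegree : ℂ) * complMul u g else 0 := by
          rw [hS, Finset.mul_sum]
          refine Finset.sum_congr rfl fun g hg => ?_
          conv_lhs => rw [natDegree_eq_sum_prime_powers hg]
          push_cast
          simp only [Finset.sum_mul, ite_mul, zero_mul]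
      _ = ∑ P ∈ monicIrreds F n, ∑ j ∈ Finset.Icc 1 n, ∑ g ∈ monics F n,
          if P ^ j ∣ g then (P.natDegree : ℂ) * complMul u g else 0 := by
          rw [Finset.sum_comm]
          exact Finset.sum_congr rfl fun P _ => Finset.sum_comm
      _ = _ := by
          refine Finset.sum_congr rfl fun P hP => Finset.sum_congr rfl fun j _ => ?_
          obtain ⟨h1, h2, -⟩ := mem_monicIrreds.mp hP
          rw [← Finset.sum_filter, sum_monics_dvd (h1.pow j), natDegree_pow]
          refine if_congr Iff.rfl ?_ rfl
          rw [hS, Finset.mul_sum]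
          refine Finset.sum_congr rfl fun h hh => ?_
          rw [complMul_mul u (h1.pow j).ne_zero (mem_monics.mp hh).1.ne_zero,
            complMul_pow_irreducible u h1 h2]
          ring
  have hR : ∑ k ∈ Finset.Icc 1 n, mangoldtSum u k * S (n - k) =
      ∑ k ∈ Finset.Icc 1 n, ∑ P ∈ monicIrreds F n, ∑ j ∈ Finset.Icc 1 n,
        if j * P.natDegree = k then (P.natDegree : ℂ) * u P ^ j * S (n - k) else 0 := by
    refine Finset.sum_congr rfl fun k hk => ?_
    rw [mangoldtSum_eq_of_le u (Finset.mem_Icc.mp hk).2]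
    simp only [Finset.sum_mul, ite_mul, zero_mul]
  rw [hL, hR]
  symm
  rw [Finset.sum_comm]
  refine Finset.sum_congr rfl fun P hP => ?_
  rw [Finset.sum_comm]
  refine Finset.sum_congr rfl fun j hj => ?_
  rw [Finset.sum_ite_eq]
  refine if_congr ?_ rfl rfl
  have h1 := (mem_monicIrreds.mp hP).2.1.natDegree_pos
  have h2 := (Finset.mem_Icc.mp hj).1
  rw [Finset.mem_Icc]
  exact ⟨fun h => h.2, fun h => ⟨Nat.mul_pos h2 h1, h⟩⟩

end MonicPolynomials

section MeanValues

variable {F : Type*} [Field F] [Fintype F]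

lemma mangoldtSum_one {k : ℕ} (hk : 1 ≤ k) :
    mangoldtSum (fun _ : F[X] => (1 : ℂ)) k = (Fintype.card F : ℂ) ^ k := by
  have hS (n : ℕ) : ∑ g ∈ monics F n, complMul (fun _ => 1) g = (Fintype.card F : ℂ) ^ n := by
    simp [complMul, card_monics]
  induction k using Nat.strong_induction_on with
  | _ k ih =>
    obtain ⟨m, rfl⟩ : ∃ m, k = m + 1 := ⟨k - 1, by omega⟩
    have h := mul_sum_complMul (F := F) (fun _ => 1) (m + 1)
    simp only [hS] at h
    have hsum : ∑ j ∈ Finset.Icc 1 m, mangoldtSum (fun _ : F[X] => (1 : ℂ)) j *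
        (Fintype.card F : ℂ) ^ (m + 1 - j) = m * (Fintype.card F : ℂ) ^ (m + 1) := by
      rw [Finset.sum_congr rfl (g := fun _ => (Fintype.card F : ℂ) ^ (m + 1))]
      · simp
      · intro j hj
        rw [Finset.mem_Icc] at hj
        rw [ih j (by omega) hj.1, ← pow_add, show j + (m + 1 - j) = m + 1 by omega]
    rw [Finset.sum_Icc_succ_top (by omega), hsum, Nat.sub_self, pow_zero, mul_one] at h
    push_cast at h
    linear_combination -h

lemma sum_prime_powers {k : ℕ} (hk : 1 ≤ k) :
    (∑ P ∈ monicIrreds F k, ∑ j ∈ Finset.Icc 1 k,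
      if j * P.natDegree = k then (P.natDegree : ℝ) else 0) = (Fintype.card F : ℝ) ^ k := by
  have h := mangoldtSum_one (F := F) hk
  simp only [mangoldtSum, one_pow, mul_one] at h
  apply_fun Complex.re at h
  rw [← Nat.cast_pow, Complex.natCast_re] at h
  push_cast at h
  rw [← h, Complex.re_sum]
  refine Finset.sum_congr rfl fun P _ => ?_
  rw [Complex.re_sum]
  refine Finset.sum_congr rfl fun j _ => ?_
  split_ifs <;> simp

lemma norm_mangoldtSum_le {u : F[X] → ℂ} (hu : ∀ P, ‖u P‖ ≤ 1) {k : ℕ} (hk : 1 ≤ k) :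
    ‖mangoldtSum u k‖ ≤ (Fintype.card F : ℝ) ^ k := by
  rw [← sum_prime_powers hk, mangoldtSum]
  refine norm_sum_le_of_le _ fun P _ => norm_sum_le_of_le _ fun j _ => ?_
  split_ifs
  · rw [norm_mul, norm_pow, Complex.norm_natCast]
    exact mul_le_of_le_one_right (Nat.cast_nonneg _) (pow_le_one₀ (norm_nonneg _) (hu P))
  · simp

open scoped Classical in
lemma le_sub_re_mangoldtSum {v : F[X] → ℂ} (hv : ∀ P, ‖v P‖ ≤ 1) {k : ℕ} (hk : 1 ≤ k) :
    k * ∑ P ∈ (monicIrreds F k).filter (natDegree · = k), (1 - (v P).re) ≤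
      (Fintype.card F : ℝ) ^ k - (mangoldtSum v k).re := by
  rw [← sum_prime_powers hk, mangoldtSum, Complex.re_sum, ← Finset.sum_sub_distrib,
    Finset.sum_filter, Finset.mul_sum]
  refine Finset.sum_le_sum fun P hP => ?_
  rw [Complex.re_sum, ← Finset.sum_sub_distrib]
  have hterm (j : ℕ) : ((if j * P.natDegree = k then (P.natDegree : ℝ) else 0) -
      (if j * P.natDegree = k then (P.natDegree : ℂ) * v P ^ j else 0 : ℂ).re) =
      if j * P.natDegree = k then (P.natDegree : ℝ) * (1 - (v P ^ j).re) else 0 := by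
    split_ifs
    · rw [← Complex.ofReal_natCast, Complex.re_ofReal_mul]; ring
    · simp
  simp only [hterm]
  have hnn (j : ℕ) : 0 ≤ if j * P.natDegree = k then (P.natDegree : ℝ) * (1 - (v P ^ j).re)
      else 0 := by
    split_ifs
    · have h1 : (v P ^ j).re ≤ 1 := (Complex.re_le_norm (v P ^ j)).trans
        (by rw [norm_pow]; exact pow_le_one₀ (norm_nonneg _) (hv P))
      exact mul_nonneg (Nat.cast_nonneg _) (by linarith)
    · exact le_rfl
  split_ifs with hd
  · refine le_trans ?_ (Finset.single_le_sum (fun j _ => hnn j) (Finset.mem_Icc.mpr ⟨le_rfl, hk⟩))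
    simp [hd]
  · rw [mul_zero]
    exact Finset.sum_nonneg fun j _ => hnn j

lemma mangoldtSum_mul_fourier (u : F[X] → ℂ) (k : ℕ) (y : UnitAddCircle) :
    mangoldtSum u k * fourier (k : ℤ) y =
      mangoldtSum (fun P => u P * fourier (P.natDegree : ℤ) y) k := by
  simp only [mangoldtSum, Finset.sum_mul, ite_mul, zero_mul]
  refine Finset.sum_congr rfl fun P _ => Finset.sum_congr rfl fun j _ => ?_
  refine ite_congr rfl (fun h => ?_) fun _ => rfl
  rw [← h, fourier_eq_pow, fourier_eq_pow, mul_pow, ← pow_mul, mul_comm j]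
  ring

lemma sum_monicIrreds_le_seqDist {u : F[X] → ℂ} (hu : ∀ P, ‖u P‖ ≤ 1) (N : ℕ)
    (y : UnitAddCircle) :
    ∑ P ∈ monicIrreds F N, (Fintype.card F : ℝ) ^ (-(P.natDegree : ℤ)) *
        (1 - (u P * fourier (P.natDegree : ℤ) y).re) ≤
      seqDist (fun k => mangoldtSum u (k + 1) / (Fintype.card F : ℂ) ^ (k + 1)) N y := by
  classical
  have hq : (0 : ℝ) < Fintype.card F := by exact_mod_cast Fintype.card_pos
  set v : F[X] → ℂ := fun P => u P * fourier (P.natDegree : ℤ) y with hv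
  have hv1 (P : F[X]) : ‖v P‖ ≤ 1 := by
    simp only [hv, norm_mul, norm_fourier_apply, mul_one, hu]
  rw [seqDist, ← Finset.sum_fiberwise_of_maps_to (t := Finset.range N)
    (g := fun P => P.natDegree - 1)]
  · refine Finset.sum_le_sum fun k hk => ?_
    rw [Finset.mem_range] at hk
    have hfil : (monicIrreds F N).filter (fun P => P.natDegree - 1 = k) =
        (monicIrreds F (k + 1)).filter (natDegree · = k + 1) := by
      ext P
      simp only [Finset.mem_filter, mem_monicIrreds]
      constructor
      · rintro ⟨⟨h1, h2, h3⟩, h4⟩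
        have := h2.natDegree_pos
        exact ⟨⟨h1, h2, by omega⟩, by omega⟩
      · rintro ⟨⟨h1, h2, h3⟩, h4⟩
        exact ⟨⟨h1, h2, by omega⟩, by omega⟩
    have hkey := le_sub_re_mangoldtSum hv1 (k := k + 1) (by omega)
    rw [← mangoldtSum_mul_fourier] at hkey
    rw [hfil, Finset.sum_congr rfl (g := fun P => (Fintype.card F : ℝ) ^ (-((k + 1 : ℕ) : ℤ)) *
      (1 - (v P).re)) fun P hP => by rw [(Finset.mem_filter.mp hP).2.symm],
      ← Finset.mul_sum, zpow_neg, zpow_natCast, le_div_iff₀ (by positivity)]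
    have hre : (mangoldtSum u (k + 1) / (Fintype.card F : ℂ) ^ (k + 1) *
        fourier (k + 1 : ℤ) y).re =
        (mangoldtSum u (k + 1) * fourier ((k + 1 : ℕ) : ℤ) y).re / (Fintype.card F : ℝ) ^ (k + 1) := by
      rw [div_mul_eq_mul_div]
      have : (Fintype.card F : ℂ) ^ (k + 1) = (((Fintype.card F : ℝ) ^ (k + 1) : ℝ) : ℂ) := by
        push_cast; rfl
      rw [this, Complex.div_ofReal_re]
      push_cast; rfl
    rw [hre]
    have hqk : (0 : ℝ) < (Fintype.card F : ℝ) ^ (k + 1) := by positivity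
    rw [one_sub_div hqk.ne', le_div_iff₀ hqk]
    push_cast at hkey ⊢
    refine le_trans (le_of_eq ?_) hkey
    field_simp
  · intro P hP
    obtain ⟨h1, h2, h3⟩ := mem_monicIrreds.mp hP
    have := h2.natDegree_pos
    rw [Finset.mem_range]; omega

/-- Halász's theorem for completely multiplicative functions: if `u` is not pretentious to any
archimedean character, then the associated completely multiplicative function has mean zero. -/
theorem tendsto_mean_complMul {u : F[X] → ℂ} (hu : ∀ P, ‖u P‖ ≤ 1)
    (hdiv : ∀ y : UnitAddCircle, Tendsto (fun N => ∑ P ∈ monicIrreds F N,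
      (Fintype.card F : ℝ) ^ (-(P.natDegree : ℤ)) *
        (1 - (u P * fourier (P.natDegree : ℤ) y).re)) atTop atTop) :
    Tendsto (fun n => (∑ g ∈ monics F n, complMul u g) / (Fintype.card F : ℂ) ^ n)
      atTop (nhds 0) := by
  refine tendsto_zero_of_seqDist
    (l := fun k => mangoldtSum u (k + 1) / (Fintype.card F : ℂ) ^ (k + 1)) ?_ ?_ ?_ ?_ ?_
  · intro n
    rw [norm_div, norm_pow, Complex.norm_natCast]
    refine div_le_one_of_le₀ ?_ (by positivity)
    refine (norm_sum_le_of_le _ fun g _ => norm_complMul_le_one hu g).trans ?_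
    simp [card_monics]
  · intro n
    rw [norm_div, norm_pow, Complex.norm_natCast]
    exact div_le_one_of_le₀ (norm_mangoldtSum_le hu (by omega)) (by positivity)
  · rw [sum_monics]
    simp [polyOf, complMul_one]
  · intro n
    have h := mul_sum_complMul (F := F) u (n + 1)
    push_cast at h
    rw [mul_div_assoc', h, Finset.sum_div]
    refine Finset.sum_nbij' (fun k => (k - 1, n + 1 - k)) (fun p => p.1 + 1) ?_ ?_ ?_ ?_ ?_
    · intro k hk
      rw [Finset.mem_Icc] at hk
      rw [Finset.HasAntidiagonal.mem_antidiagonal]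
      simp only
      omega
    · intro p hp
      rw [Finset.HasAntidiagonal.mem_antidiagonal] at hp
      rw [Finset.mem_Icc]
      omega
    · intro k hk
      rw [Finset.mem_Icc] at hk
      simp only
      omega
    · intro p hp
      rw [Finset.HasAntidiagonal.mem_antidiagonal] at hp
      ext <;> simp only <;> omega
    · intro k hk
      rw [Finset.mem_Icc] at hk
      simp only
      rw [Nat.sub_add_cancel hk.1, div_mul_div_comm, ← pow_add, Nat.add_sub_cancel' hk.2]
  · intro y
    exact tendsto_atTop_mono (fun N => sum_monicIrreds_le_seqDist hu N y) (hdiv y)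

end MeanValues

section Pretentious

variable {F : Type*} [Field F]

lemma conj_eTheta (g : F[X]) {θ : ℝ} {y : UnitAddCircle} (hθ : (θ : UnitAddCircle) = -y) :
    (starRingEnd ℂ) (eTheta θ g) = fourier (g.natDegree : ℤ) y := by
  have h : eTheta θ g = fourier (g.natDegree : ℤ) (θ : UnitAddCircle) := by
    rw [fourier_coe_apply, eTheta]
    congr 1
    push_cast
    ring
  rw [h, ← fourier_neg, hθ, fourier_apply, fourier_apply, neg_smul_neg]

lemma isShortIntervalChar_one : IsShortIntervalChar (fun _ : F[X] => (1 : ℂ)) :=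
  ⟨fun _ _ _ => (one_mul 1).symm, ⟨0, one_ne_zero⟩, 0, fun _ _ _ _ _ => rfl⟩

lemma IsDirichletChar.conj {χ : F[X] → ℂ} (hχ : IsDirichletChar χ) :
    IsDirichletChar fun g => (starRingEnd ℂ) (χ g) := by
  obtain ⟨h1, s, hs, h2, h3⟩ := hχ
  refine ⟨fun g h => by simp only [h1, map_mul], s, hs, fun g h hgh => ?_, fun g => ?_⟩
  · simp only [h2 g h hgh]
  · rw [← h3 g, Ne, Ne, map_eq_zero]

lemma tendsto_atTop_of_tendsto_sqrt {a : ℕ → ℝ}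
    (h : Tendsto (fun n => Real.sqrt (a n)) atTop atTop) : Tendsto a atTop atTop := by
  refine tendsto_atTop_mono' _ ?_ h
  filter_upwards [h.eventually_ge_atTop 1] with n hn
  have h0 : 0 ≤ a n := by
    by_contra hneg
    rw [Real.sqrt_eq_zero_of_nonpos (not_le.mp hneg).le] at hn
    linarith
  nlinarith [Real.sq_sqrt h0]

variable [Fintype F]

lemma pretDist_eq_sqrt_sum (f g : F[X] → ℂ) (N : ℕ) :
    pretDist f g N = Real.sqrt (∑ P ∈ monicIrreds F N,
      (Fintype.card F : ℝ) ^ (-(P.natDegree : ℤ)) * (1 - (f P * (starRingEnd ℂ) (g P)).re)) := by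
  have hset : (monicIrreds F N : Set F[X]) =
      {P | P.Monic ∧ Irreducible P ∧ P.natDegree ≤ N} := by
    ext P
    rw [Finset.mem_coe, mem_monicIrreds, Set.mem_ofPred_eq]
  rw [pretDist, ← Finset.tsum_subtype', hset]
  rfl

/-- Non-pretentiousness of `f` implies that the twists of the completely multiplicative function
attached to `f` by Dirichlet characters have mean zero. -/
theorem tendsto_mean_twist {f χ : F[X] → ℂ} (hfb : ∀ g, ‖f g‖ ≤ 1)
    (hpret : ∀ χ ξ : F[X] → ℂ, ∀ θ : ℝ,
      IsDirichletChar χ → IsShortIntervalChar ξ → θ ∈ Set.Ico (0 : ℝ) 1 →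
      Tendsto (fun N : ℕ => pretDist f (fun g => χ g * ξ g * eTheta θ g) N) atTop atTop)
    (hχ : IsDirichletChar χ) (hχb : ∀ g, ‖χ g‖ ≤ 1) :
    Tendsto (fun n => (∑ g ∈ monics F n, complMul (fun P => f P * χ P) g) /
      (Fintype.card F : ℂ) ^ n) atTop (nhds 0) := by
  refine tendsto_mean_complMul (fun P => ?_) fun y => ?_
  · rw [norm_mul]
    exact mul_le_one₀ (hfb P) (norm_nonneg _) (hχb P)
  · obtain ⟨r, hr⟩ := QuotientAddGroup.mk_surjective y
    have hθ : ((Int.fract (-r) : ℝ) : UnitAddCircle) = -y := by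
      rw [← hr, ← Int.self_sub_floor, AddCircle.coe_sub]
      have : ((⌊-r⌋ : ℝ) : UnitAddCircle) = 0 := by
        rw [AddCircle.coe_eq_zero_iff]
        exact ⟨⌊-r⌋, by simp⟩
      rw [this, sub_zero]
      rfl
    have h := hpret _ _ _ hχ.conj isShortIntervalChar_one
      ⟨Int.fract_nonneg (-r), Int.fract_lt_one (-r)⟩
    simp only [pretDist_eq_sqrt_sum] at h
    refine (tendsto_atTop_of_tendsto_sqrt h).congr fun N => Finset.sum_congr rfl fun P _ => ?_
    rw [map_mul, map_mul, conj_eTheta P hθ, map_one, mul_one, Complex.conj_conj, mul_assoc]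

end Pretentious

section CharacterExpansion

lemma sum_mulChar_eq_zero {M : Type*} [CommMonoid M] [Finite M] [Fintype (MulChar M ℂ)]
    {a : M} (ha : a ≠ 1) : ∑ χ : MulChar M ℂ, χ a = 0 := by
  obtain ⟨χ, hχ⟩ := MulChar.exists_apply_ne_one_of_hasEnoughRootsOfUnity M ℂ ha
  refine eq_zero_of_mul_eq_self_left hχ ?_
  simp only [Finset.mul_sum, ← MulChar.mul_apply]
  exact Fintype.sum_bijective _ (Group.mulLeft_bijective χ) _ _ fun χ' ↦ rfl

/-- A function supported on the units of a finite commutative monoid is a linear combination of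
multiplicative characters. -/
lemma exists_eq_sum_mulChar {M : Type*} [CommMonoid M] [Finite M] [Fintype (MulChar M ℂ)]
    (b : M → ℂ) (hb : ∀ x, ¬ IsUnit x → b x = 0) :
    ∃ c : MulChar M ℂ → ℂ, ∀ x, b x = ∑ χ, c χ * χ x := by
  have := Fintype.ofFinite Mˣ
  have hcard : (Fintype.card (MulChar M ℂ) : ℂ) ≠ 0 := by exact_mod_cast Fintype.card_ne_zero
  refine ⟨fun χ => (∑ a : Mˣ, b a * χ (a⁻¹ : Mˣ)) / Fintype.card (MulChar M ℂ), fun x => ?_⟩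
  by_cases hx : IsUnit x
  · obtain ⟨u, rfl⟩ := hx
    simp only [div_mul_eq_mul_div]
    rw [← Finset.sum_div, eq_div_iff hcard]
    simp only [Finset.sum_mul, mul_assoc, ← map_mul, ← Units.val_mul]
    rw [Finset.sum_comm]
    simp only [← Finset.mul_sum]
    rw [Finset.sum_eq_single u]
    · simp
    · intro a _ hau
      rw [sum_mulChar_eq_zero, mul_zero]
      intro h
      rw [Units.val_eq_one, inv_mul_eq_one] at h
      exact hau h
    · simp
  · rw [hb x hx]
    symm
    exact Finset.sum_eq_zero fun χ _ => by rw [χ.map_nonunit hx, mul_zero]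

lemma norm_mulChar_le_one {M : Type*} [CommMonoid M] [Finite M] (χ : MulChar M ℂ) (x : M) :
    ‖χ x‖ ≤ 1 := by
  by_cases hx : IsUnit x
  · obtain ⟨u, rfl⟩ := hx
    refine (Complex.norm_eq_one_of_pow_eq_one (n := Nat.card Mˣ) ?_ Nat.card_pos.ne').le
    rw [← map_pow, ← Units.val_pow_eq_pow_val, pow_card_eq_one', Units.val_one, map_one]
  · rw [χ.map_nonunit hx]
    simp

variable {F : Type*} [Field F]

lemma isUnit_quotient_mk_iff {g W : F[X]} :
    IsUnit (Ideal.Quotient.mk (Ideal.span {W}) g) ↔ IsCoprime g W := by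
  rw [isUnit_iff_exists_inv]
  constructor
  · rintro ⟨x, hx⟩
    obtain ⟨h, rfl⟩ := Ideal.Quotient.mk_surjective x
    rw [← map_mul, ← map_one (Ideal.Quotient.mk _), Ideal.Quotient.mk_eq_mk_iff_sub_mem,
      Ideal.mem_span_singleton] at hx
    obtain ⟨k, hk⟩ := hx
    exact ⟨h, -k, by linear_combination hk⟩
  · rintro ⟨h, k, hk⟩
    refine ⟨Ideal.Quotient.mk _ h, ?_⟩
    rw [← map_mul, ← map_one (Ideal.Quotient.mk _), Ideal.Quotient.mk_eq_mk_iff_sub_mem,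
      Ideal.mem_span_singleton]
    exact ⟨-k, by linear_combination hk⟩

lemma isDirichletChar_mulChar {W : F[X]} (hW : W ≠ 0) (χ : MulChar (F[X] ⧸ Ideal.span {W}) ℂ) :
    IsDirichletChar fun g => χ (Ideal.Quotient.mk _ g) := by
  refine ⟨fun g h => by simp only [map_mul], W, hW, fun g h hgh => ?_, fun g => ?_⟩
  · simp only
    rw [Ideal.Quotient.mk_eq_mk_iff_sub_mem _ _ |>.mpr (Ideal.mem_span_singleton.mpr hgh)]
  · rw [← isUnit_quotient_mk_iff]
    exact ⟨fun h => by_contra fun hn => h (χ.map_nonunit hn), fun h => (h.map χ).ne_zero⟩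

lemma complMul_mul_char (u : F[X] → ℂ) (χ : F[X] →* ℂ) {g : F[X]} (hg : g.Monic) :
    complMul u g * χ g = complMul (fun P => u P * χ P) g := by
  conv_lhs => rw [← prod_monicFactors hg, map_multiset_prod, prod_monicFactors hg]
  rw [complMul, complMul, Multiset.prod_map_mul]

variable [Fintype F]

/-- Under non-pretentiousness, the completely multiplicative function attached to `f` has mean
zero against periodic functions supported on residues coprime to the modulus. -/
theorem tendsto_mean_complMul_periodic {f : F[X] → ℂ} (hfb : ∀ g, ‖f g‖ ≤ 1)
    (hpret : ∀ χ ξ : F[X] → ℂ, ∀ θ : ℝ,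
      IsDirichletChar χ → IsShortIntervalChar ξ → θ ∈ Set.Ico (0 : ℝ) 1 →
      Tendsto (fun N : ℕ => pretDist f (fun g => χ g * ξ g * eTheta θ g) N) atTop atTop)
    {W : F[X]} (hW : W.Monic) {b : F[X] → ℂ} (hb : ∀ g h, W ∣ g - h → b g = b h)
    (hb0 : ∀ g, ¬ IsCoprime g W → b g = 0) :
    Tendsto (fun n => (∑ g ∈ monics F n, complMul f g * b g) / (Fintype.card F : ℂ) ^ n)
      atTop (nhds 0) := by
  have := hW.finite_quotient
  have : Finite (F[X] ⧸ Ideal.span {W}) := Module.finite_of_finite F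
  have hsurj : Function.Surjective (Ideal.Quotient.mk (Ideal.span {W})) :=
    Ideal.Quotient.mk_surjective
  have := Fintype.ofFinite (MulChar (F[X] ⧸ Ideal.span {W}) ℂ)
  obtain ⟨c, hc⟩ := exists_eq_sum_mulChar (M := F[X] ⧸ Ideal.span {W})
    (fun x => b (Function.surjInv hsurj x)) fun x hx => hb0 _ fun h => hx <| by
      rwa [← isUnit_quotient_mk_iff, Function.surjInv_eq hsurj] at h
  have hbc (g : F[X]) : b g = ∑ χ, c χ * χ (Ideal.Quotient.mk _ g) := by
    rw [← hc]
    refine hb _ _ ?_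
    rw [← Ideal.mem_span_singleton, ← Ideal.Quotient.mk_eq_mk_iff_sub_mem,
      Function.surjInv_eq hsurj]
  have hlim : Tendsto (fun n => ∑ χ : MulChar (F[X] ⧸ Ideal.span {W}) ℂ, c χ *
      ((∑ g ∈ monics F n, complMul (fun P => f P * χ (Ideal.Quotient.mk _ P)) g) /
        (Fintype.card F : ℂ) ^ n)) atTop (nhds 0) := by
    rw [show (0 : ℂ) = ∑ χ : MulChar (F[X] ⧸ Ideal.span {W}) ℂ, c χ * 0 by simp]
    exact tendsto_finsetSum _ fun χ _ => (tendsto_mean_twist hfb hpret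
      (isDirichletChar_mulChar hW.ne_zero χ) fun g => norm_mulChar_le_one χ _).const_mul _
  refine hlim.congr fun n => ?_
  simp only [mul_div_assoc', Finset.mul_sum]
  rw [← Finset.sum_div, Finset.sum_comm]
  congr 1
  refine Finset.sum_congr rfl fun g hg => ?_
  rw [hbc g, Finset.mul_sum]
  refine Finset.sum_congr rfl fun χ _ => ?_
  have h := complMul_mul_char f (χ.toMonoidHom.comp
    (Ideal.Quotient.mk (Ideal.span {W}) : F[X] →* F[X] ⧸ Ideal.span {W})) (mem_monics.mp hg).1
  simp only [MonoidHom.comp_apply] at h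
  rw [mul_left_comm]
  exact congrArg (c χ * ·) h.symm

end CharacterExpansion

section SmoothRough

variable {F : Type*} [Field F]

lemma isCoprime_multiset_prod_left {m : Multiset F[X]} {g : F[X]} (h : ∀ P ∈ m, IsCoprime P g) :
    IsCoprime m.prod g := by
  induction m using Multiset.induction_on with
  | empty => simpa using isCoprime_one_left
  | cons P m ih =>
    rw [Multiset.prod_cons]
    exact (h P (Multiset.mem_cons_self P m)).mul_left
      (ih fun Q hQ => h Q (Multiset.mem_cons_of_mem hQ))

open scoped Classical in
/-- The largest monic divisor of `g` composed of the prime factors of `W`. -/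
noncomputable def smoothPart (W g : F[X]) : F[X] := ((monicFactors g).filter (· ∣ W)).prod

open scoped Classical in
/-- The largest monic divisor of `g` without prime factors dividing `W`. -/
noncomputable def roughPart (W g : F[X]) : F[X] := ((monicFactors g).filter (¬ · ∣ W)).prod

lemma smoothPart_mul_roughPart (W : F[X]) {g : F[X]} (hg : g.Monic) :
    smoothPart W g * roughPart W g = g := by
  classical
  rw [smoothPart, roughPart, ← Multiset.prod_add, Multiset.filter_add_not, prod_monicFactors hg]

lemma monic_smoothPart (W g : F[X]) : (smoothPart W g).Monic := by
  classical
  exact monic_multiset_prod fun _ hP => monic_of_mem_monicFactors (Multiset.mem_filter.mp hP).1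

lemma isCoprime_roughPart (W g : F[X]) : IsCoprime (roughPart W g) W := by
  classical
  exact isCoprime_multiset_prod_left fun _ hP => ((irreducible_of_mem_monicFactors
    (Multiset.mem_filter.mp hP).1).coprime_iff_not_dvd).mpr (Multiset.mem_filter.mp hP).2

lemma isCoprime_smoothPart_roughPart (W g : F[X]) :
    IsCoprime (smoothPart W g) (roughPart W g) := by
  classical
  exact isCoprime_multiset_prod_left fun _ hP =>
    ((isCoprime_roughPart W g).of_isCoprime_of_dvd_right (Multiset.mem_filter.mp hP).2).symm

lemma dvd_of_mem_monicFactors_smoothPart {W g P : F[X]} (hP : P ∈ monicFactors (smoothPart W g)) :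
    P ∣ W := by
  classical
  rw [smoothPart, monicFactors_multiset_prod] at hP
  · exact (Multiset.mem_filter.mp hP).2
  · intro Q hQ
    have := (Multiset.mem_filter.mp hQ).1
    exact ⟨monic_of_mem_monicFactors this, irreducible_of_mem_monicFactors this⟩

lemma smoothPart_mul_eq {W d h : F[X]} (hd : d.Monic) (hdW : ∀ P ∈ monicFactors d, P ∣ W)
    (hh : h ≠ 0) (hhW : IsCoprime h W) : smoothPart W (d * h) = d := by
  classical
  rw [smoothPart, monicFactors_mul hd.ne_zero hh, Multiset.filter_add,
    Multiset.filter_eq_self.mpr hdW, Multiset.filter_eq_nil.mpr, add_zero, prod_monicFactors hd]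
  intro P hP hPW
  exact (irreducible_of_mem_monicFactors hP).not_isUnit
    (hhW.isUnit_of_dvd' ((mem_monicFactors hh).mp hP).2.2 hPW)

lemma roughPart_mul_of_smoothPart_eq {W d h : F[X]} (hd : d.Monic) (hh : h.Monic)
    (hs : smoothPart W (d * h) = d) : roughPart W (d * h) = h := by
  have := smoothPart_mul_roughPart W (hd.mul hh)
  rw [hs] at this
  exact mul_left_cancel₀ hd.ne_zero this

lemma smoothPart_mul_eq_iff {W d h : F[X]} (hd : d.Monic) (hdW : ∀ P ∈ monicFactors d, P ∣ W)
    (hh : h.Monic) : smoothPart W (d * h) = d ↔ IsCoprime h W := by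
  refine ⟨fun hs => ?_, smoothPart_mul_eq hd hdW hh.ne_zero⟩
  rw [← roughPart_mul_of_smoothPart_eq hd hh hs]
  exact isCoprime_roughPart W _

lemma map_multiset_prod_of_nodup {f : F[X] → ℂ} (hf : IsMultFn f) (h1 : f 1 = 1)
    {m : Multiset F[X]} (hm : ∀ P ∈ m, P.Monic ∧ Irreducible P) (hn : m.Nodup) :
    f m.prod = (m.map f).prod := by
  induction m using Multiset.induction_on with
  | empty => simpa using h1
  | cons P m ih =>
    rw [Multiset.nodup_cons] at hn
    have hm' : ∀ Q ∈ m, Q.Monic ∧ Irreducible Q := fun Q hQ => hm Q (Multiset.mem_cons_of_mem hQ)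
    obtain ⟨hPm, hPi⟩ := hm P (Multiset.mem_cons_self P m)
    rw [Multiset.prod_cons, Multiset.map_cons, Multiset.prod_cons, ← ih hm' hn.2]
    refine hf _ _ (hPi.coprime_iff_not_dvd.mpr fun hdvd => hn.1 ?_)
    have h0 : m.prod ≠ 0 := (monic_multiset_prod fun Q hQ => (hm' Q hQ).1).ne_zero
    rw [← monicFactors_multiset_prod hm', mem_monicFactors h0]
    exact ⟨hPm, hPi, hdvd⟩

/-- If `g` has no square divisor of degree larger than `2 z` and `W` is divisible by all primes of
degree at most `z`, then the rough part of `g` is squarefree. -/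
lemma map_eq_of_no_large_square {f : F[X] → ℂ} (hf : IsMultFn f) (h1 : f 1 = 1) {z : ℕ}
    {W : F[X]} (hW : ∀ P : F[X], P.Monic → Irreducible P → P.natDegree ≤ z → P ∣ W)
    {g : F[X]} (hg : g.Monic) (hsq : ∀ Q : F[X], Q.Monic → Q ^ 2 ∣ g → Q.natDegree ≤ z) :
    f g = f (smoothPart W g) * complMul f (roughPart W g) := by
  classical
  have hm : ∀ P ∈ (monicFactors g).filter (¬ · ∣ W), P.Monic ∧ Irreducible P := fun P hP =>
    ⟨monic_of_mem_monicFactors (Multiset.mem_filter.mp hP).1,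
      irreducible_of_mem_monicFactors (Multiset.mem_filter.mp hP).1⟩
  conv_lhs => rw [← smoothPart_mul_roughPart W hg]
  rw [hf _ _ (isCoprime_smoothPart_roughPart W g), complMul, roughPart,
    monicFactors_multiset_prod hm, map_multiset_prod_of_nodup hf h1 hm]
  rw [Multiset.nodup_iff_count_le_one]
  intro P
  by_contra hc
  have hP : P ∈ (monicFactors g).filter (¬ · ∣ W) :=
    Multiset.count_pos.mp (by omega)
  obtain ⟨hPm, hPi⟩ := hm P hP
  refine (Multiset.mem_filter.mp hP).2 (hW P hPm hPi (hsq P hPm ?_))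
  rw [pow_dvd_iff_le_count hg.ne_zero hPm hPi]
  exact le_trans (by omega) (Multiset.count_le_of_le P (Multiset.filter_le (¬ · ∣ W) _))

lemma natDegree_smoothPart_le {z : ℕ} {W : F[X]} (hW : W.Monic) {g : F[X]} (hg : g.Monic)
    (hsq : ∀ Q : F[X], Q.Monic → Q ^ 2 ∣ g → Q.natDegree ≤ z) :
    (smoothPart W g).natDegree ≤ (2 * z + 1) * W.natDegree := by
  classical
  have hle : (monicFactors g).filter (· ∣ W) ≤ (2 * z + 1) • monicFactors W := by
    rw [Multiset.le_iff_count]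
    intro P
    by_cases hP : P ∈ (monicFactors g).filter (· ∣ W)
    · have hPg := (Multiset.mem_filter.mp hP).1
      have hPm := monic_of_mem_monicFactors hPg
      have hPi := irreducible_of_mem_monicFactors hPg
      have hPW : 1 ≤ (monicFactors W).count P := Multiset.one_le_count_iff_mem.mpr
        ((mem_monicFactors hW.ne_zero).mpr ⟨hPm, hPi, (Multiset.mem_filter.mp hP).2⟩)
      have hc : (monicFactors g).count P ≤ 2 * z + 1 := by
        by_contra hc
        have := hsq (P ^ (z + 1)) (hPm.pow _) (by
          rw [← pow_mul, pow_dvd_iff_le_count hg.ne_zero hPm hPi]; omega)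
        rw [natDegree_pow] at this
        have := hPi.natDegree_pos
        nlinarith
      rw [Multiset.count_nsmul]
      have := Multiset.count_le_of_le P (Multiset.filter_le (· ∣ W) (monicFactors g))
      nlinarith
    · rw [Multiset.count_eq_zero_of_notMem hP]
      exact Nat.zero_le _
  have hdvd : smoothPart W g ∣ W ^ (2 * z + 1) := by
    have := Multiset.prod_dvd_prod_of_le hle
    rwa [Multiset.prod_nsmul, prod_monicFactors hW] at this
  have := natDegree_le_of_dvd hdvd (pow_ne_zero _ hW.ne_zero)
  rwa [natDegree_pow] at this

variable [Fintype F]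

open scoped Classical in
lemma sum_smoothPart_fiber {M : Type*} [AddCommMonoid M] {W d : F[X]} (hd : d.Monic)
    (hdW : ∀ P ∈ monicFactors d, P ∣ W) (n : ℕ) (φ : F[X] → M) :
    ∑ g ∈ (monics F n).filter (smoothPart W · = d), φ g =
      if d.natDegree ≤ n then
        ∑ h ∈ monics F (n - d.natDegree), if IsCoprime h W then φ (d * h) else 0
      else 0 := by
  have hfil : (monics F n).filter (smoothPart W · = d) =
      ((monics F n).filter (d ∣ ·)).filter (smoothPart W · = d) := by
    ext g
    simp only [Finset.mem_filter, and_assoc]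
    refine and_congr_right fun hg => ⟨fun h => ⟨⟨roughPart W g, ?_⟩, h⟩, fun h => h.2⟩
    rw [← h, smoothPart_mul_roughPart W (mem_monics.mp hg).1]
  rw [hfil, Finset.sum_filter, sum_monics_dvd hd]
  refine if_congr Iff.rfl (Finset.sum_congr rfl fun h hh => ?_) rfl
  simp only [smoothPart_mul_eq_iff hd hdW (mem_monics.mp hh).1]

open scoped Classical in
/-- Few monic polynomials are divisible by a large square. -/
lemma card_large_square_le (z n : ℕ) :
    (((monics F n).filter fun g => ∃ Q : F[X], Q.Monic ∧ Q ^ 2 ∣ g ∧ z < Q.natDegree).card : ℝ) ≤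
      (Fintype.card F : ℝ) ^ n * (1 / 2) ^ z := by
  have hq2 : (2 : ℝ) ≤ Fintype.card F := by exact_mod_cast Fintype.one_lt_card
  set q : ℝ := (Fintype.card F : ℝ) with hq
  have hsub : ((monics F n).filter fun g => ∃ Q : F[X], Q.Monic ∧ Q ^ 2 ∣ g ∧ z < Q.natDegree) ⊆
      (Finset.Ico (z + 1) (n + 1)).biUnion fun d => (monics F d).biUnion fun Q =>
        (monics F n).filter (Q ^ 2 ∣ ·) := by
    intro g hg
    obtain ⟨hg, Q, hQ, hQg, hz⟩ := Finset.mem_filter.mp hg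
    obtain ⟨hgm, hgn⟩ := mem_monics.mp hg
    have hdeg := natDegree_le_of_dvd hQg hgm.ne_zero
    rw [natDegree_pow] at hdeg
    simp only [Finset.mem_biUnion, Finset.mem_Ico, Finset.mem_filter]
    exact ⟨Q.natDegree, ⟨by omega, by omega⟩, Q, mem_monics.mpr ⟨hQ, rfl⟩, hg, hQg⟩
  have hcard (d : ℕ) (Q : F[X]) (hQ : Q ∈ monics F d) :
      (((monics F n).filter (Q ^ 2 ∣ ·)).card : ℝ) ≤ q ^ n / (q ^ d * q ^ d) := by
    obtain ⟨hQm, hQd⟩ := mem_monics.mp hQ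
    rw [Finset.card_eq_sum_ones, sum_monics_dvd (hQm.pow 2), natDegree_pow, hQd]
    split_ifs with h
    · rw [← Finset.card_eq_sum_ones, card_monics, le_div_iff₀ (by positivity), Nat.cast_pow,
        ← hq, ← pow_add, ← pow_add]
      exact le_of_eq (by congr 1; omega)
    · rw [Nat.cast_zero]; positivity
  calc (((monics F n).filter fun g => ∃ Q : F[X], Q.Monic ∧ Q ^ 2 ∣ g ∧ z < Q.natDegree).card : ℝ)
      ≤ ∑ d ∈ Finset.Ico (z + 1) (n + 1), ∑ Q ∈ monics F d,
          (((monics F n).filter (Q ^ 2 ∣ ·)).card : ℝ) := by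
        exact_mod_cast (Finset.card_le_card hsub).trans (Finset.card_biUnion_le.trans
          (Finset.sum_le_sum fun d _ => Finset.card_biUnion_le))
    _ ≤ ∑ d ∈ Finset.Ico (z + 1) (n + 1), ∑ Q ∈ monics F d, q ^ n / (q ^ d * q ^ d) :=
        Finset.sum_le_sum fun d _ => Finset.sum_le_sum fun Q hQ => hcard d Q hQ
    _ ≤ ∑ d ∈ Finset.Ico (z + 1) (n + 1), q ^ n * (1 / 2) ^ d := by
        refine Finset.sum_le_sum fun d _ => ?_
        rw [Finset.sum_const, card_monics, nsmul_eq_mul, Nat.cast_pow, ← hq]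
        have : q ^ d * (q ^ n / (q ^ d * q ^ d)) = q ^ n * (1 / q) ^ d := by
          rw [one_div, inv_pow]; field_simp
        rw [this]
        gcongr
    _ ≤ q ^ n * (1 / 2) ^ z := by
        rw [← Finset.mul_sum]
        refine mul_le_mul_of_nonneg_left ?_ (by positivity)
        refine (geom_sum_Ico_le_of_lt_one (by norm_num) (by norm_num)).trans (le_of_eq ?_)
        rw [pow_succ]; ring

end SmoothRough

section Aperiodicity

variable {F : Type*} [Field F] [Fintype F]

open scoped Classical in
/-- The contribution of the polynomials with smooth part `d` has mean zero. -/
lemma tendsto_mean_smoothPart_fiber {f : F[X] → ℂ} (hfb : ∀ g, ‖f g‖ ≤ 1)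
    (hpret : ∀ χ ξ : F[X] → ℂ, ∀ θ : ℝ,
      IsDirichletChar χ → IsShortIntervalChar ξ → θ ∈ Set.Ico (0 : ℝ) 1 →
      Tendsto (fun N : ℕ => pretDist f (fun g => χ g * ξ g * eTheta θ g) N) atTop atTop)
    {W : F[X]} (hW : W.Monic) {a : F[X] → ℂ} (ha : ∀ g h, W ∣ g - h → a g = a h)
    {d : F[X]} (hd : d.Monic) (hdW : ∀ P ∈ monicFactors d, P ∣ W) :
    Tendsto (fun n => (∑ g ∈ (monics F n).filter (smoothPart W · = d),
      f (smoothPart W g) * complMul f (roughPart W g) * a g) / (Fintype.card F : ℂ) ^ n)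
      atTop (nhds 0) := by
  have hq : (Fintype.card F : ℂ) ≠ 0 := by exact_mod_cast Fintype.card_ne_zero
  have hlim := tendsto_mean_complMul_periodic hfb hpret hW
    (b := fun h => if IsCoprime h W then a (d * h) else 0) (by
      intro g h hgh
      have hcop : IsCoprime g W ↔ IsCoprime h W := by
        obtain ⟨k, hk⟩ := hgh
        rw [show g = h + W * k by linear_combination hk]
        exact IsCoprime.add_mul_left_left_iff
      have hper : a (d * g) = a (d * h) :=
        ha _ _ (by rw [← mul_sub]; exact Dvd.dvd.mul_left hgh d)
      simp only [hcop, hper]) (by intro g hg; simp only [if_neg hg])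
  rw [← tendsto_add_atTop_iff_nat d.natDegree]
  have hlim' := hlim.const_mul (f d / (Fintype.card F : ℂ) ^ d.natDegree)
  rw [mul_zero] at hlim'
  refine hlim'.congr fun n => ?_
  rw [sum_smoothPart_fiber hd hdW, if_pos (Nat.le_add_left _ _), Nat.add_sub_cancel,
    div_mul_div_comm, ← pow_add, add_comm d.natDegree n, Finset.mul_sum]
  congr 1
  refine Finset.sum_congr rfl fun h hh => ?_
  split_ifs with hc
  · have hs := smoothPart_mul_eq hd hdW (mem_monics.mp hh).1.ne_zero hc
    rw [hs, roughPart_mul_of_smoothPart_eq hd (mem_monics.mp hh).1 hs, mul_assoc]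
  · simp

open scoped Classical in
/-- The contribution of the polynomials with smooth part of bounded degree has mean zero. -/
lemma tendsto_mean_smoothPart_le {f : F[X] → ℂ} (hfb : ∀ g, ‖f g‖ ≤ 1)
    (hpret : ∀ χ ξ : F[X] → ℂ, ∀ θ : ℝ,
      IsDirichletChar χ → IsShortIntervalChar ξ → θ ∈ Set.Ico (0 : ℝ) 1 →
      Tendsto (fun N : ℕ => pretDist f (fun g => χ g * ξ g * eTheta θ g) N) atTop atTop)
    {W : F[X]} (hW : W.Monic) {a : F[X] → ℂ} (ha : ∀ g h, W ∣ g - h → a g = a h) (K : ℕ) :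
    Tendsto (fun n => (∑ g ∈ (monics F n).filter (fun g => (smoothPart W g).natDegree ≤ K),
      f (smoothPart W g) * complMul f (roughPart W g) * a g) / (Fintype.card F : ℂ) ^ n)
      atTop (nhds 0) := by
  set T : Finset F[X] := ((Finset.range (K + 1)).biUnion (monics F)).filter
    fun d => ∀ P ∈ monicFactors d, P ∣ W with hT
  have hmem (d : F[X]) : d ∈ T ↔ (d.Monic ∧ d.natDegree ≤ K) ∧ ∀ P ∈ monicFactors d, P ∣ W := by
    simp only [hT, Finset.mem_filter, Finset.mem_biUnion, Finset.mem_range, mem_monics]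
    refine and_congr_left fun _ => ⟨?_, fun h => ⟨_, by omega, h.1, rfl⟩⟩
    rintro ⟨k, hk, hm, rfl⟩
    exact ⟨hm, by omega⟩
  have hlim := tendsto_finsetSum T fun d hd =>
    tendsto_mean_smoothPart_fiber hfb hpret hW ha ((hmem d).mp hd).1.1 ((hmem d).mp hd).2
  rw [Finset.sum_const_zero] at hlim
  refine hlim.congr fun n => ?_
  rw [← Finset.sum_div]
  congr 1
  symm
  rw [← Finset.sum_fiberwise_of_maps_to (t := T) (g := smoothPart W)]
  · refine Finset.sum_congr rfl fun d hd => Finset.sum_congr ?_ fun _ _ => rfl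
    ext g
    simp only [Finset.mem_filter, and_assoc]
    refine and_congr_right fun _ => ⟨fun h => h.2, fun h => ⟨?_, h⟩⟩
    rw [h]
    exact ((hmem d).mp hd).1.2
  · intro g hg
    rw [Finset.mem_filter] at hg
    exact (hmem _).mpr ⟨⟨monic_smoothPart W g, hg.2⟩,
      fun P hP => dvd_of_mem_monicFactors_smoothPart hP⟩

/-- A non-pretentious multiplicative function has mean zero over monic polynomials against any
bounded periodic function. -/
theorem tendsto_mean_monics {f : F[X] → ℂ} (hf : IsMultFn f) (hfb : ∀ g, ‖f g‖ ≤ 1)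
    (hpret : ∀ χ ξ : F[X] → ℂ, ∀ θ : ℝ,
      IsDirichletChar χ → IsShortIntervalChar ξ → θ ∈ Set.Ico (0 : ℝ) 1 →
      Tendsto (fun N : ℕ => pretDist f (fun g => χ g * ξ g * eTheta θ g) N) atTop atTop)
    (h1 : f 1 = 1) {s : F[X]} (hs : s.Monic) {a : F[X] → ℂ} (ha : ∀ g h, s ∣ g - h → a g = a h)
    {A : ℝ} (hA : ∀ g, ‖a g‖ ≤ A) :
    Tendsto (fun n => (∑ g ∈ monics F n, f g * a g) / (Fintype.card F : ℂ) ^ n)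
      atTop (nhds 0) := by
  classical
  have hq : (0 : ℝ) < Fintype.card F := by exact_mod_cast Fintype.card_pos
  have hA0 : 0 ≤ A := (norm_nonneg _).trans (hA 0)
  rw [Metric.tendsto_atTop]
  intro ε hε
  have hz : ∃ z : ℕ, 2 * A * (1 / 2 : ℝ) ^ z < ε / 2 := by
    have h := (tendsto_pow_atTop_nhds_zero_of_lt_one (r := (1 / 2 : ℝ)) (by norm_num)
      (by norm_num)).const_mul (2 * A)
    rw [mul_zero] at h
    exact (h.eventually (gt_mem_nhds (half_pos hε))).exists
  obtain ⟨z, hz⟩ := hz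
  set W : F[X] := s * ∏ P ∈ monicIrreds F z, P with hWdef
  have hW : W.Monic := hs.mul (monic_prod_of_monic _ _ fun P hP => (mem_monicIrreds.mp hP).1)
  have hWz (P : F[X]) (hm : P.Monic) (hi : Irreducible P) (hd : P.natDegree ≤ z) : P ∣ W :=
    (Finset.dvd_prod_of_mem (fun P => P) (mem_monicIrreds.mpr ⟨hm, hi, hd⟩)).trans
      (dvd_mul_left _ _)
  set K := (2 * z + 1) * W.natDegree with hK
  have hmain := tendsto_mean_smoothPart_le hfb hpret hW
    (fun g h hgh => ha g h ((dvd_mul_right _ _).trans hgh)) K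
  rw [Metric.tendsto_atTop] at hmain
  obtain ⟨n₀, hn₀⟩ := hmain (ε / 2) (half_pos hε)
  refine ⟨n₀, fun n hn => ?_⟩
  have hmain := hn₀ n hn
  rw [dist_zero_right] at hmain ⊢
  set E : F[X] → ℂ := fun g => if (smoothPart W g).natDegree ≤ K then
    f (smoothPart W g) * complMul f (roughPart W g) * a g else 0 with hE
  rw [Finset.sum_filter] at hmain
  have hEb (g : F[X]) : ‖E g‖ ≤ A := by
    simp only [hE]
    split_ifs
    · rw [norm_mul, norm_mul]
      have := norm_complMul_le_one hfb (roughPart W g)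
      calc _ ≤ 1 * 1 * A := by gcongr; exacts [hfb _, hA _]
        _ = A := by ring
    · simpa using hA0
  have hfa (g : F[X]) : ‖f g * a g‖ ≤ A := by
    rw [norm_mul]
    calc _ ≤ 1 * A := by gcongr; exacts [hfb _, hA _]
      _ = A := one_mul A
  have hdiff : ‖∑ g ∈ monics F n, f g * a g - ∑ g ∈ monics F n, E g‖ ≤
      2 * A * ((Fintype.card F : ℝ) ^ n * (1 / 2) ^ z) := by
    rw [← Finset.sum_sub_distrib]
    calc ‖∑ g ∈ monics F n, (f g * a g - E g)‖
        ≤ ∑ g ∈ monics F n,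
          if ∃ Q : F[X], Q.Monic ∧ Q ^ 2 ∣ g ∧ z < Q.natDegree then 2 * A else 0 := by
          refine norm_sum_le_of_le _ fun g hg => ?_
          have hgm := (mem_monics.mp hg).1
          split_ifs with hbad
          · refine (norm_sub_le _ _).trans ?_
            linarith [hEb g, hfa g]
          · have hsq (Q : F[X]) (hQ : Q.Monic) (hQg : Q ^ 2 ∣ g) : Q.natDegree ≤ z :=
              not_lt.mp fun h => hbad ⟨Q, hQ, hQg, h⟩
            simp only [hE]
            rw [if_pos (natDegree_smoothPart_le hW hgm hsq),
              ← map_eq_of_no_large_square hf h1 hWz hgm hsq, sub_self, norm_zero]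
      _ ≤ _ := by
          rw [← Finset.sum_filter, Finset.sum_const, nsmul_eq_mul, mul_comm]
          exact mul_le_mul_of_nonneg_left (card_large_square_le z n) (by positivity)
  have hsplit : (∑ g ∈ monics F n, f g * a g) / (Fintype.card F : ℂ) ^ n =
      (∑ g ∈ monics F n, f g * a g - ∑ g ∈ monics F n, E g) / (Fintype.card F : ℂ) ^ n +
      (∑ g ∈ monics F n, E g) / (Fintype.card F : ℂ) ^ n := by ring
  rw [hsplit]
  refine (norm_add_le _ _).trans_lt ?_
  have hfirst : ‖(∑ g ∈ monics F n, f g * a g - ∑ g ∈ monics F n, E g) /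
      (Fintype.card F : ℂ) ^ n‖ ≤ 2 * A * (1 / 2) ^ z := by
    rw [norm_div, norm_pow, Complex.norm_natCast, div_le_iff₀ (by positivity)]
    linarith
  linarith

open scoped Classical in
/-- Polynomials of degree at most `n` are those of degree less than `n` together with the nonzero
multiples of the monic polynomials of degree `n`. -/
lemma sum_polyOf_succ (n : ℕ) (φ : F[X] → ℂ) :
    ∑ c : Fin (n + 1) → F, φ (polyOf c) =
      ∑ c : Fin n → F, φ (polyOf c) + ∑ x : Fˣ, ∑ g ∈ monics F n, φ (C (x : F) * g) := by
  have hpoly (x : F) (c : Fin n → F) :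
      polyOf (Fin.snoc c x : Fin (n + 1) → F) = polyOf c + C x * X ^ n := by
    rw [polyOf, Fin.sum_univ_castSucc, polyOf]
    simp
  have hsplit : ∑ c : Fin (n + 1) → F, φ (polyOf c) =
      ∑ x : F, ∑ c : Fin n → F, φ (polyOf c + C x * X ^ n) := by
    rw [← Equiv.sum_comp (Fin.snocEquiv fun _ : Fin (n + 1) => F), Fintype.sum_prod_type]
    refine Finset.sum_congr rfl fun x _ => Finset.sum_congr rfl fun c _ => ?_
    rw [← hpoly]
    rfl
  have hzero : ∑ x : F, ∑ c : Fin n → F, φ (polyOf c + C x * X ^ n) =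
      ∑ c : Fin n → F, φ (polyOf c) +
        ∑ x : Fˣ, ∑ c : Fin n → F, φ (polyOf c + C (x : F) * X ^ n) := by
    rw [Fintype.sum_eq_add_sum_subtype_ne _ (0 : F),
      ← Equiv.sum_comp (unitsEquivNeZero (G₀ := F))]
    simp
  rw [hsplit, hzero]
  congr 1
  refine Finset.sum_congr rfl fun x _ => ?_
  rw [sum_monics, ← Equiv.sum_comp (MulAction.toPerm x : Equiv.Perm (Fin n → F))]
  refine Finset.sum_congr rfl fun c _ => congrArg φ ?_
  rw [mul_add, add_comm, MulAction.toPerm_apply]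
  congr 1
  simp only [polyOf, Finset.mul_sum]
  refine Finset.sum_congr rfl fun i _ => ?_
  rw [Pi.smul_apply, Units.smul_def, smul_eq_mul, C_mul, mul_assoc]

lemma tendsto_div_pow_of_succ {q : ℕ} (hq : 2 ≤ q) {T U : ℕ → ℂ}
    (hT : ∀ n, T (n + 1) = T n + U n)
    (hU : Tendsto (fun n => U n / (q : ℂ) ^ n) atTop (nhds 0)) :
    Tendsto (fun n => T n / (q : ℂ) ^ n) atTop (nhds 0) := by
  have hq0 : (q : ℂ) ≠ 0 := by exact_mod_cast (by omega : q ≠ 0)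
  have hq1 : (1 : ℝ) < q := by exact_mod_cast hq
  have hsum (n : ℕ) : T n = T 0 + ∑ k ∈ Finset.range n, U k := by
    induction n with
    | zero => simp
    | succ n ih => rw [hT, ih, Finset.sum_range_succ, add_assoc]
  have hU' : U =o[atTop] fun n => (q : ℝ) ^ n := by
    refine (Asymptotics.isLittleO_of_tendsto (fun n h => ?_) hU).trans_isBigO
      (Asymptotics.IsBigO.of_bound 1 (Eventually.of_forall fun n => ?_))
    · exact absurd h (pow_ne_zero n hq0)
    · simp
  have hgeom : Tendsto (fun n => ∑ k ∈ Finset.range n, (q : ℝ) ^ k) atTop atTop := by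
    refine tendsto_atTop_mono (fun n => ?_) tendsto_natCast_atTop_atTop
    calc (n : ℝ) = ∑ k ∈ Finset.range n, (1 : ℝ) := by simp
      _ ≤ _ := Finset.sum_le_sum fun k _ => one_le_pow₀ hq1.le
  have hbig := hU'.sum_range (fun n => by positivity) hgeom
  have hle : (fun n => ∑ k ∈ Finset.range n, (q : ℝ) ^ k) =O[atTop] fun n => (q : ℝ) ^ n := by
    refine Asymptotics.IsBigO.of_bound 1 (Eventually.of_forall fun n => ?_)
    have h0 : 0 ≤ ∑ k ∈ Finset.range n, (q : ℝ) ^ k := Finset.sum_nonneg fun k _ => by positivity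
    rw [Real.norm_of_nonneg h0, norm_pow, Real.norm_natCast, one_mul]
    exact_mod_cast (Nat.geomSum_lt hq fun k hk => Finset.mem_range.mp hk).le
  have hconst : (fun _ : ℕ => T 0) =o[atTop] fun n => (q : ℝ) ^ n :=
    Asymptotics.isLittleO_const_left.mpr <| Or.inr <|
      tendsto_norm_atTop_atTop.comp (tendsto_pow_atTop_atTop_of_one_lt hq1)
  have htot : T =o[atTop] fun n => (q : ℂ) ^ n := by
    refine ((hconst.add (hbig.trans_isBigO hle)).congr_left fun n => (hsum n).symm).trans_isBigO
      (Asymptotics.IsBigO.of_bound 1 (by simp))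
  exact htot.tendsto_div_nhds_zero

end Aperiodicity

theorem stmt17 {F : Type*} [Field F] [Fintype F]
    (f : Polynomial F → ℂ) (hf : IsMultFn f) (hfb : ∀ g, ‖f g‖ ≤ 1)
    (hpret : ∀ χ ξ : Polynomial F → ℂ, ∀ θ : ℝ,
      IsDirichletChar χ → IsShortIntervalChar ξ → θ ∈ Set.Ico (0 : ℝ) 1 →
      Tendsto (fun N : ℕ => pretDist f (fun g => χ g * ξ g * eTheta θ g) N) atTop atTop) :
    IsAperiodicFn f := by
  classical
  intro s hs a
  have hf1 : f 1 = f 1 * f 1 := by simpa using hf 1 1 isCoprime_one_left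
  obtain h0 | h1 : f 1 = 0 ∨ f 1 = 1 := by
    by_cases h : f 1 = 0
    · exact Or.inl h
    · exact Or.inr (mul_left_cancel₀ h (by rw [← hf1, mul_one]))
  · have hzero (g : F[X]) : f g = 0 := by
      have := hf g 1 isCoprime_one_right
      rwa [h0, mul_one, mul_zero] at this
    simp [hzero]
  have hs' : (s * C s.leadingCoeff⁻¹).Monic := monic_mul_leadingCoeff_inv hs
  have := hs'.finite_quotient
  have hspan : Ideal.span {s * C s.leadingCoeff⁻¹} = Ideal.span {s} :=
    Ideal.span_singleton_mul_right_unit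
      (isUnit_C.mpr (inv_ne_zero (leadingCoeff_ne_zero.mpr hs)).isUnit) s
  have hfin : Finite (F[X] ⧸ Ideal.span {s}) := by
    rw [← hspan]
    exact Module.finite_of_finite F
  obtain ⟨A, hA⟩ := (Set.finite_range fun x => ‖a x‖).bddAbove
  have hA' (x) : ‖a x‖ ≤ A := hA (Set.mem_range_self x)
  set b : F[X] → ℂ := fun g => (starRingEnd ℂ) (a (Ideal.Quotient.mk (Ideal.span {s}) g)) with hb
  have hbper (x : F) (g h : F[X]) (hgh : s * C s.leadingCoeff⁻¹ ∣ g - h) :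
      b (C x * g) = b (C x * h) := by
    simp only [hb]
    congr 2
    rw [Ideal.Quotient.mk_eq_mk_iff_sub_mem, ← mul_sub, Ideal.mem_span_singleton]
    exact Dvd.dvd.mul_left ((dvd_mul_right _ _).trans hgh) _
  have hunit (x : Fˣ) (g : F[X]) : f (C (x : F) * g) = f (C (x : F)) * f g :=
    hf _ _ ⟨C ((x⁻¹ : Fˣ) : F), 0, by rw [← C_mul, Units.inv_mul, C_1, zero_mul, add_zero]⟩
  have hU : Tendsto (fun n => (∑ x : Fˣ, ∑ g ∈ monics F n, f (C (x : F) * g) * b (C (x : F) * g)) /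
      (Fintype.card F : ℂ) ^ n) atTop (nhds 0) := by
    have hlim := tendsto_finsetSum (Finset.univ : Finset Fˣ) fun x _ =>
      (tendsto_mean_monics hf hfb hpret h1 hs' (a := fun g => b (C (x : F) * g))
        (hbper x) (A := A) (fun g => by simpa [hb] using hA' _)).const_mul (f (C (x : F)))
    simp only [mul_zero, Finset.sum_const_zero] at hlim
    refine hlim.congr fun n => ?_
    rw [Finset.sum_div]
    refine Finset.sum_congr rfl fun x _ => ?_
    rw [mul_div_assoc', Finset.mul_sum]
    congr 1
    exact Finset.sum_congr rfl fun g _ => by rw [hunit, mul_assoc]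
  refine (tendsto_div_pow_of_succ (T := fun n => ∑ c : Fin n → F, f (polyOf c) * b (polyOf c))
    Fintype.one_lt_card (fun n => sum_polyOf_succ n fun g => f g * b g) hU).congr fun n => ?_
  rw [one_div, inv_mul_eq_div]
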